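/- arXiv:math/0605619 — 2 statements merged into one kernel-verified Lean document; each statement's English description precedes it below -/
import Mathlib

section
/- Assume (H1)–(H3). There exists a unique constant λ̄ ∈ ℝ such that the equation w_t + G(x,y,t,D_x w, D_y w) = λ̄ on ℝⁿ×ℝ×ℝ admits both a bounded upper semicontinuous viscosity subsolution and a bounded lower semicontinuous viscosity supersolution. -/
open MeasureTheory Topology Filter
open scoped RealInnerProductSpace

noncomputable section

/-- Euclidean space ℝⁿ. -/
abbrev Euc (n : ℕ) := EuclideanSpace ℝ (Fin n)

/-- Hamiltonians G = G(x, y, t, p_x, p_y). -/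
abbrev Ham (n : ℕ) := Euc n → ℝ → ℝ → Euc n → ℝ → ℝ

/-- The space of points (x, y, t) ∈ ℝⁿ×ℝ×ℝ. -/
abbrev Dom (n : ℕ) := Euc n × ℝ × ℝ

/-- The space of points ξ = (x, y, t, p_x, p_y). -/
abbrev Xi (n : ℕ) := Euc n × ℝ × ℝ × Euc n × ℝ

/-- The space of points (x, t) ∈ ℝⁿ×ℝ. -/
abbrev Dom2 (n : ℕ) := Euc n × ℝ

/-- The integer vector k viewed as a point of ℝⁿ. -/
def intVec {n : ℕ} (k : Fin n → ℤ) : Euc n := WithLp.toLp 2 fun i => (k i : ℝ)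

/-- ∂φ/∂t for φ = φ(x,y,t). -/
def pdT {n : ℕ} (φ : Dom n → ℝ) (z : Dom n) : ℝ := fderiv ℝ φ z (0, 0, 1)

/-- ∂φ/∂y for φ = φ(x,y,t). -/
def pdY {n : ℕ} (φ : Dom n → ℝ) (z : Dom n) : ℝ := fderiv ℝ φ z (0, 1, 0)

/-- D_x φ for φ = φ(x,y,t). -/
def pdX {n : ℕ} (φ : Dom n → ℝ) (z : Dom n) : Euc n :=
  WithLp.toLp 2 fun i => fderiv ℝ φ z (EuclideanSpace.single i 1, 0, 0)

/-- ∂φ/∂t for φ = φ(x,t). -/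
def pdT2 {n : ℕ} (φ : Dom2 n → ℝ) (z : Dom2 n) : ℝ := fderiv ℝ φ z (0, 1)

/-- D_x φ for φ = φ(x,t). -/
def pdX2 {n : ℕ} (φ : Dom2 n → ℝ) (z : Dom2 n) : Euc n :=
  WithLp.toLp 2 fun i => fderiv ℝ φ z (EuclideanSpace.single i 1, 0)

/-- Viscosity subsolution of `w_t + G(x,y,t,D_x w,D_y w) + α w = λ` on ℝⁿ×ℝ×ℝ. -/
def ViscSub {n : ℕ} (G : Ham n) (α lam : ℝ) (u : Dom n → ℝ) : Prop :=
  UpperSemicontinuous u ∧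
  ∀ φ : Dom n → ℝ, ContDiff ℝ 1 φ → ∀ z : Dom n,
    IsLocalMax (fun w => u w - φ w) z →
    pdT φ z + G z.1 z.2.1 z.2.2 (pdX φ z) (pdY φ z) + α * u z ≤ lam

/-- Viscosity supersolution of `w_t + G(x,y,t,D_x w,D_y w) + α w = λ` on ℝⁿ×ℝ×ℝ. -/
def ViscSuper {n : ℕ} (G : Ham n) (α lam : ℝ) (u : Dom n → ℝ) : Prop :=
  LowerSemicontinuous u ∧
  ∀ φ : Dom n → ℝ, ContDiff ℝ 1 φ → ∀ z : Dom n,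
    IsLocalMin (fun w => u w - φ w) z →
    lam ≤ pdT φ z + G z.1 z.2.1 z.2.2 (pdX φ z) (pdY φ z) + α * u z

/-- Viscosity solution of `w_t + G(x,y,t,D_x w,D_y w) + α w = λ` on ℝⁿ×ℝ×ℝ. -/
def ViscSol {n : ℕ} (G : Ham n) (α lam : ℝ) (u : Dom n → ℝ) : Prop :=
  Continuous u ∧ ViscSub G α lam u ∧ ViscSuper G α lam u

/-- ℤⁿ-periodicity in x, 1-periodicity in y and t. -/
def STPeriodic {n : ℕ} (u : Dom n → ℝ) : Prop :=
  (∀ (k : Fin n → ℤ) (x : Euc n) (y t : ℝ), u (x + intVec k, y, t) = u (x, y, t)) ∧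
  (∀ x y t, u (x, y + 1, t) = u (x, y, t)) ∧
  (∀ x y t, u (x, y, t + 1) = u (x, y, t))

/-- Boundedness of a function on ℝⁿ×ℝ×ℝ. -/
def Bdd {n : ℕ} (u : Dom n → ℝ) : Prop := ∃ M, ∀ z, |u z| ≤ M

/-- (H1) : continuity and periodicity of the Hamiltonian. -/
def HypH1 {n : ℕ} (G : Ham n) : Prop :=
  Continuous (fun ξ : Xi n => G ξ.1 ξ.2.1 ξ.2.2.1 ξ.2.2.2.1 ξ.2.2.2.2) ∧
  (∀ (k : Fin n → ℤ) x y t px py, G (x + intVec k) y t px py = G x y t px py) ∧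
  (∀ x y t px py, G x (y + 1) t px py = G x y t px py) ∧
  (∀ x y t px py, G x y (t + 1) px py = G x y t px py)

/-- (H2) : coercivity in p_x at p_y = 0, with constants C₁, C₂ > 0. -/
def HypH2 {n : ℕ} (G : Ham n) (C₁ C₂ : ℝ) : Prop :=
  0 < C₁ ∧ 0 < C₂ ∧ ∀ x y t px, C₁ * ‖px‖ - C₂ ≤ G x y t px 0

/-- (H2') : coercivity in p_x, locally uniformly in p_y. -/
def HypH2' {n : ℕ} (F : Ham n) : Prop :=
  ∀ R : ℝ, 0 < R → ∃ C₁ C₂ : ℝ, 0 < C₁ ∧ 0 < C₂ ∧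
    ∀ x y t px py, |py| ≤ R → C₁ * ‖px‖ - C₂ ≤ F x y t px py

/-- (H3) : local Lipschitz continuity in (y,t,p_y) and a.e. bounds on the
partial derivatives ∂_y G, ∂_t G, ∂_{p_y} G. -/
def HypH3 {n : ℕ} (G : Ham n) (l C₃ C₄ C₅ : ℝ) : Prop :=
  0 ≤ C₃ ∧ 0 ≤ C₄ ∧ 0 ≤ C₅ ∧
  (∀ (x px : Euc n), LocallyLipschitz (fun q : ℝ × ℝ × ℝ => G x q.1 q.2.1 px q.2.2)) ∧
  (∀ᵐ ξ ∂(volume : Measure (Xi n)),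
    |deriv (fun y => G ξ.1 y ξ.2.2.1 ξ.2.2.2.1 ξ.2.2.2.2) ξ.2.1| ≤ C₃ * |ξ.2.2.2.2 + l| ∧
    |deriv (fun t => G ξ.1 ξ.2.1 t ξ.2.2.2.1 ξ.2.2.2.2) ξ.2.2.1| ≤
      C₄ * (1 + |ξ.2.2.2.2| + |G ξ.1 ξ.2.1 ξ.2.2.1 ξ.2.2.2.1 ξ.2.2.2.2|) ∧
    |deriv (fun py => G ξ.1 ξ.2.1 ξ.2.2.1 ξ.2.2.2.1 py) ξ.2.2.2.2| ≤ C₅)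

/-- λ is an ergodic constant : bounded usc subsolution and bounded lsc
supersolution of `w_t + G = λ` exist. -/
def ErgodicConst {n : ℕ} (G : Ham n) (lam : ℝ) : Prop :=
  (∃ u, Bdd u ∧ ViscSub G 0 lam u) ∧ (∃ v, Bdd v ∧ ViscSuper G 0 lam v)

/-- λ solves the cell problem at (p_x,p_y) : the equation
`v_t + F(x,y,t,p_x + D_x v, p_y + D_y v) = λ` has a bounded space-time periodic
usc subsolution and a bounded space-time periodic lsc supersolution. -/
def CellOk {n : ℕ} (F : Ham n) (px : Euc n) (py lam : ℝ) : Prop :=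
  (∃ u, Bdd u ∧ STPeriodic u ∧
    ViscSub (fun x y t qx qy => F x y t (px + qx) (py + qy)) 0 lam u) ∧
  (∃ v, Bdd v ∧ STPeriodic v ∧
    ViscSuper (fun x y t qx qy => F x y t (px + qx) (py + qy)) 0 lam v)

/-- Viscosity subsolution of `w_t + G(x,y,t,D_x w,D_y w) = 0` on ℝⁿ×ℝ×(0,∞). -/
def ViscSubPos {n : ℕ} (G : Ham n) (u : Dom n → ℝ) : Prop :=
  ∀ φ : Dom n → ℝ, ContDiff ℝ 1 φ → ∀ z : Dom n, 0 < z.2.2 →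
    IsLocalMax (fun w => u w - φ w) z →
    pdT φ z + G z.1 z.2.1 z.2.2 (pdX φ z) (pdY φ z) ≤ 0

/-- Viscosity supersolution of `w_t + G(x,y,t,D_x w,D_y w) = 0` on ℝⁿ×ℝ×(0,∞). -/
def ViscSuperPos {n : ℕ} (G : Ham n) (u : Dom n → ℝ) : Prop :=
  ∀ φ : Dom n → ℝ, ContDiff ℝ 1 φ → ∀ z : Dom n, 0 < z.2.2 →
    IsLocalMin (fun w => u w - φ w) z →
    0 ≤ pdT φ z + G z.1 z.2.1 z.2.2 (pdX φ z) (pdY φ z)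

/-- Bounded uniformly continuous (on every slab ℝⁿ×ℝ×[0,T]) viscosity solution of the
initial value problem `v_t + G(x,y,t,D_x v,D_y v) = 0` on ℝⁿ×ℝ×(0,∞), `v(x,y,0) = v₀(x,y)`. -/
def IVPSol {n : ℕ} (G : Ham n) (v₀ : Dom2 n → ℝ) (v : Dom n → ℝ) : Prop :=
  ContinuousOn v {z : Dom n | 0 ≤ z.2.2} ∧
  (∀ x y, v (x, y, 0) = v₀ (x, y)) ∧
  ViscSubPos G v ∧ ViscSuperPos G v ∧
  (∀ T : ℝ, 0 < T →
    (∃ M, ∀ z : Dom n, 0 ≤ z.2.2 → z.2.2 ≤ T → |v z| ≤ M) ∧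
    UniformContinuousOn v {z : Dom n | 0 ≤ z.2.2 ∧ z.2.2 ≤ T})

/-- Viscosity subsolution of the eikonal-type inequality `w_t + c|D_x w| - C ≤ 0` on ℝⁿ×ℝ. -/
def ViscSubEik {n : ℕ} (c C : ℝ) (u : Dom2 n → ℝ) : Prop :=
  UpperSemicontinuous u ∧
  ∀ φ : Dom2 n → ℝ, ContDiff ℝ 1 φ → ∀ z : Dom2 n,
    IsLocalMax (fun w => u w - φ w) z →
    pdT2 φ z + c * ‖pdX2 φ z‖ - C ≤ 0

instance xi1 (n : ℕ) : SFinite (volume : Measure (Euc n × ℝ)) := inferInstance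
instance xi2 (n : ℕ) : SFinite (volume : Measure (ℝ × Euc n × ℝ)) := inferInstance
instance xi3 (n : ℕ) : SFinite (volume : Measure (ℝ × ℝ × Euc n × ℝ)) := inferInstance
instance xi4 (n : ℕ) : SFinite (volume : Measure (Xi n)) := inferInstance
instance xo2 (n : ℕ) : (volume : Measure (ℝ × Euc n × ℝ)).IsOpenPosMeasure := inferInstance
instance xo3 (n : ℕ) : (volume : Measure (ℝ × ℝ × Euc n × ℝ)).IsOpenPosMeasure := inferInstance
instance xo4 (n : ℕ) : (volume : Measure (Xi n)).IsOpenPosMeasure := inferInstance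
instance xa1 (n : ℕ) : (volume : Measure (Euc n × ℝ)).IsAddRightInvariant := inferInstanceAs (((volume : Measure (Euc n)).prod volume).IsAddRightInvariant)
instance xa2 (n : ℕ) : (volume : Measure (ℝ × Euc n × ℝ)).IsAddRightInvariant := inferInstanceAs (((volume : Measure ℝ).prod volume).IsAddRightInvariant)
instance xa3 (n : ℕ) : (volume : Measure (ℝ × ℝ × Euc n × ℝ)).IsAddRightInvariant :=  inferInstanceAs (((volume : Measure ℝ).prod volume).IsAddRightInvariant)
set_option synthInstance.maxHeartbeats 200000 in
set_option synthInstance.maxSize 1000 in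
instance xa4 (n : ℕ) : (volume : Measure (Xi n)).IsAddRightInvariant := Measure.prod.instIsAddRightInvariant (μ := (volume : Measure (Euc n))) (ν := (volume : Measure (ℝ × ℝ × Euc n × ℝ)))

lemma line_lip {f : ℝ → ℝ} (hf : LocallyLipschitz f) {C a b : ℝ}
    (h : ∀ᵐ s : ℝ, s ∈ Set.uIoc a b → |deriv f s| ≤ C) : |f b - f a| ≤ C * |b - a| := by
  obtain ⟨K, hK⟩ := (hf.locallyLipschitzOn (s := Set.uIcc a b)).exists_lipschitzOnWith_of_compact
    isCompact_uIcc
  rw [← hK.absolutelyContinuousOnInterval.integral_deriv_eq_sub, ← Real.norm_eq_abs]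
  exact intervalIntegral.norm_integral_le_of_norm_le_const_ae (by simpa using h)

lemma ae_line {n : ℕ} {P : Xi n → Prop} (h : ∀ᵐ ξ ∂(volume : Measure (Xi n)), P ξ) (e : Xi n) :
    ∀ᵐ ξ ∂(volume : Measure (Xi n)), ∀ᵐ s : ℝ, P (ξ + s • e) := by
  have hq : Measure.QuasiMeasurePreserving (fun p : ℝ × Xi n => p.2 + p.1 • e)
      ((volume : Measure ℝ).prod volume) volume := by
    refine QuasiMeasurePreserving.prod_of_right ?_ ?_
    · exact Continuous.measurable (by fun_prop)
    · refine ae_of_all _ fun s => ?_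
      exact (measurePreserving_add_right volume (s • e)).quasiMeasurePreserving
  have h2 := hq.ae h
  have h3 := (Measure.measurePreserving_swap (μ := (volume : Measure (Xi n)))
    (ν := (volume : Measure ℝ))).quasiMeasurePreserving.ae h2
  exact Measure.ae_ae_of_ae_prod h3

lemma all_of_ae_closed {n : ℕ} {S : Set (Xi n)} (hS : IsClosed S)
    (h : ∀ᵐ ξ ∂(volume : Measure (Xi n)), ξ ∈ S) (ξ : Xi n) : ξ ∈ S := by
  have hd : Dense S := Measure.dense_of_ae h
  rw [← hS.closure_eq]; exact hd ξ

lemma lipY {n : ℕ} {G : Ham n} {l C₃ C₄ C₅ : ℝ} (h1 : HypH1 G) (h3 : HypH3 G l C₃ C₄ C₅)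
    (x : Euc n) (y y' t : ℝ) (p : Euc n) (q : ℝ) :
    |G x y' t p q - G x y t p q| ≤ C₃ * |q + l| * |y' - y| := by
  obtain ⟨-, -, -, hl, hae⟩ := h3
  have hG := h1.1
  have key : ∀ s : ℝ, ∀ ξ : Xi n, |G ξ.1 (ξ.2.1 + s) ξ.2.2.1 ξ.2.2.2.1 ξ.2.2.2.2 -
      G ξ.1 ξ.2.1 ξ.2.2.1 ξ.2.2.2.1 ξ.2.2.2.2| ≤ C₃ * |ξ.2.2.2.2 + l| * |s| := by
    intro s
    refine all_of_ae_closed (S := {ξ : Xi n | |G ξ.1 (ξ.2.1 + s) ξ.2.2.1 ξ.2.2.2.1 ξ.2.2.2.2 -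
      G ξ.1 ξ.2.1 ξ.2.2.1 ξ.2.2.2.1 ξ.2.2.2.2| ≤ C₃ * |ξ.2.2.2.2 + l| * |s|}) ?_ ?_
    · refine isClosed_le ?_ (by fun_prop)
      refine Continuous.abs (Continuous.sub ?_ hG)
      exact hG.comp (f := fun ξ : Xi n => ((ξ.1, ξ.2.1 + s, ξ.2.2.1, ξ.2.2.2.1, ξ.2.2.2.2) : Xi n))
        (by fun_prop)
    · filter_upwards [ae_line hae (0, 1, 0, 0, 0)] with ξ hξ
      have hf : LocallyLipschitz
          (fun r => G ξ.1 (ξ.2.1 + r) ξ.2.2.1 ξ.2.2.2.1 ξ.2.2.2.2) := by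
        refine (hl ξ.1 ξ.2.2.2.1).comp (g := fun r : ℝ => (ξ.2.1 + r, ξ.2.2.1, ξ.2.2.2.2)) ?_
        exact ContDiff.locallyLipschitz (𝕂 := ℝ) (by fun_prop)
      have := line_lip hf (C := C₃ * |ξ.2.2.2.2 + l|) (a := 0) (b := s) (by
        filter_upwards [hξ] with r hr _
        have := hr.1
        simp at this
        have h5 : deriv (fun r => G ξ.1 (ξ.2.1 + r) ξ.2.2.1 ξ.2.2.2.1 ξ.2.2.2.2) r =
          deriv (fun y => G ξ.1 y ξ.2.2.1 ξ.2.2.2.1 ξ.2.2.2.2) (ξ.2.1 + r) :=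
          deriv_comp_const_add (fun y => G ξ.1 y ξ.2.2.1 ξ.2.2.2.1 ξ.2.2.2.2) ξ.2.1 r
        rw [h5]; exact this)
      simpa using this
  simpa using key (y' - y) (x, y, t, p, q)

lemma lipQ {n : ℕ} {G : Ham n} {l C₃ C₄ C₅ : ℝ} (h1 : HypH1 G) (h3 : HypH3 G l C₃ C₄ C₅)
    (x : Euc n) (y t : ℝ) (p : Euc n) (q q' : ℝ) :
    |G x y t p q' - G x y t p q| ≤ C₅ * |q' - q| := by
  obtain ⟨-, -, -, hl, hae⟩ := h3
  have hG := h1.1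
  have key : ∀ s : ℝ, ∀ ξ : Xi n, |G ξ.1 ξ.2.1 ξ.2.2.1 ξ.2.2.2.1 (ξ.2.2.2.2 + s) -
      G ξ.1 ξ.2.1 ξ.2.2.1 ξ.2.2.2.1 ξ.2.2.2.2| ≤ C₅ * |s| := by
    intro s
    refine all_of_ae_closed (S := {ξ : Xi n | |G ξ.1 ξ.2.1 ξ.2.2.1 ξ.2.2.2.1 (ξ.2.2.2.2 + s) -
      G ξ.1 ξ.2.1 ξ.2.2.1 ξ.2.2.2.1 ξ.2.2.2.2| ≤ C₅ * |s|}) ?_ ?_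
    · refine isClosed_le ?_ (by fun_prop)
      refine Continuous.abs (Continuous.sub ?_ hG)
      exact hG.comp (f := fun ξ : Xi n => ((ξ.1, ξ.2.1, ξ.2.2.1, ξ.2.2.2.1, ξ.2.2.2.2 + s) : Xi n))
        (by fun_prop)
    · filter_upwards [ae_line hae (0, 0, 0, 0, 1)] with ξ hξ
      have hf : LocallyLipschitz
          (fun r => G ξ.1 ξ.2.1 ξ.2.2.1 ξ.2.2.2.1 (ξ.2.2.2.2 + r)) := by
        refine (hl ξ.1 ξ.2.2.2.1).comp (g := fun r : ℝ => (ξ.2.1, ξ.2.2.1, ξ.2.2.2.2 + r)) ?_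
        exact ContDiff.locallyLipschitz (𝕂 := ℝ) (by fun_prop)
      have := line_lip hf (C := C₅) (a := 0) (b := s) (by
        filter_upwards [hξ] with r hr _
        have := hr.2.2
        simp at this
        have h5 : deriv (fun r => G ξ.1 ξ.2.1 ξ.2.2.1 ξ.2.2.2.1 (ξ.2.2.2.2 + r)) r =
          deriv (fun y => G ξ.1 ξ.2.1 ξ.2.2.1 ξ.2.2.2.1 y) (ξ.2.2.2.2 + r) :=
          deriv_comp_const_add (fun y => G ξ.1 ξ.2.1 ξ.2.2.1 ξ.2.2.2.1 y) ξ.2.2.2.2 r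
        rw [h5]; exact this)
      simpa using this
  simpa using key (q' - q) (x, y, t, p, q)

/-- One-dimensional estimate replacing Gronwall. -/
lemma line_gron {f : ℝ → ℝ} (hf : LocallyLipschitz f) {C A s : ℝ} (hC : 0 ≤ C) (hA : 0 ≤ A)
    (hs : C * |s| ≤ 1 / 2)
    (h : ∀ᵐ r : ℝ, |deriv f r| ≤ C * (A + |f r|)) :
    |f s - f 0| ≤ 2 * C * |s| * (A + |f 0|) := by
  obtain ⟨m, hm, hmax⟩ := (isCompact_uIcc (a := (0:ℝ)) (b := s)).exists_isMaxOn
    ⟨0, Set.left_mem_uIcc⟩ (f := fun r => |f r|) (hf.continuous.abs.continuousOn)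
  have hb : ∀ b ∈ Set.uIcc (0:ℝ) s, |f b - f 0| ≤ C * (A + |f m|) * |b - 0| := by
    intro b hb
    refine line_lip hf ?_
    filter_upwards [h] with r hr hr2
    have : r ∈ Set.uIcc (0:ℝ) s :=
      (Set.uIcc_subset_uIcc_left hb) (Set.uIoc_subset_uIcc hr2)
    have h6 : |f r| ≤ |f m| := hmax this
    refine hr.trans ?_
    gcongr
  have hms : |m| ≤ |s| := by
    have := Set.abs_sub_left_of_mem_uIcc hm
    simpa using this
  have e1 := hb m hm
  have e2 := hb s Set.right_mem_uIcc
  simp only [sub_zero] at e1 e2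
  have e3 : |f m| ≤ |f 0| + |f m - f 0| := by
    have := abs_add_le (f 0) (f m - f 0); simpa using this
  have e4 : C * (A + |f m|) * |m| ≤ (A + |f m|) * (1/2) := by
    have : C * |m| ≤ 1/2 := (mul_le_mul_of_nonneg_left hms hC).trans hs
    have h0 : 0 ≤ A + |f m| := by positivity
    nlinarith
  have e5 : A + |f m| ≤ 2 * (A + |f 0|) := by linarith
  have h0 : 0 ≤ C * |s| := by positivity
  nlinarith

lemma lipT {n : ℕ} {G : Ham n} {l C₃ C₄ C₅ : ℝ} (h1 : HypH1 G) (h3 : HypH3 G l C₃ C₄ C₅)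
    (x : Euc n) (y t t' : ℝ) (p : Euc n) (q : ℝ) (ht : C₄ * |t' - t| ≤ 1 / 2) :
    |G x y t' p q - G x y t p q| ≤ 2 * C₄ * |t' - t| * (1 + |q| + |G x y t p q|) := by
  obtain ⟨-, hC, -, hl, hae⟩ := h3
  have hG := h1.1
  have key : ∀ s : ℝ, C₄ * |s| ≤ 1 / 2 →
      ∀ ξ : Xi n, |G ξ.1 ξ.2.1 (ξ.2.2.1 + s) ξ.2.2.2.1 ξ.2.2.2.2 -
      G ξ.1 ξ.2.1 ξ.2.2.1 ξ.2.2.2.1 ξ.2.2.2.2| ≤ 2 * C₄ * |s| * (1 + |ξ.2.2.2.2| +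
        |G ξ.1 ξ.2.1 ξ.2.2.1 ξ.2.2.2.1 ξ.2.2.2.2|) := by
    intro s hs
    refine all_of_ae_closed (S := {ξ : Xi n | |G ξ.1 ξ.2.1 (ξ.2.2.1 + s) ξ.2.2.2.1 ξ.2.2.2.2 -
      G ξ.1 ξ.2.1 ξ.2.2.1 ξ.2.2.2.1 ξ.2.2.2.2| ≤ 2 * C₄ * |s| * (1 + |ξ.2.2.2.2| +
        |G ξ.1 ξ.2.1 ξ.2.2.1 ξ.2.2.2.1 ξ.2.2.2.2|)}) ?_ ?_
    · refine isClosed_le ?_ (by fun_prop)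
      refine Continuous.abs (Continuous.sub ?_ hG)
      exact hG.comp (f := fun ξ : Xi n => ((ξ.1, ξ.2.1, ξ.2.2.1 + s, ξ.2.2.2.1, ξ.2.2.2.2) : Xi n))
        (by fun_prop)
    · filter_upwards [ae_line hae (0, 0, 1, 0, 0)] with ξ hξ
      have hf : LocallyLipschitz
          (fun r => G ξ.1 ξ.2.1 (ξ.2.2.1 + r) ξ.2.2.2.1 ξ.2.2.2.2) := by
        refine (hl ξ.1 ξ.2.2.2.1).comp (g := fun r : ℝ => (ξ.2.1, ξ.2.2.1 + r, ξ.2.2.2.2)) ?_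
        exact ContDiff.locallyLipschitz (𝕂 := ℝ) (by fun_prop)
      have := line_gron hf (C := C₄) (A := 1 + |ξ.2.2.2.2|) (s := s) hC (by positivity) hs (by
        filter_upwards [hξ] with r hr
        have := hr.2.1
        simp at this
        have h5 : deriv (fun r => G ξ.1 ξ.2.1 (ξ.2.2.1 + r) ξ.2.2.2.1 ξ.2.2.2.2) r =
          deriv (fun y => G ξ.1 ξ.2.1 y ξ.2.2.2.1 ξ.2.2.2.2) (ξ.2.2.1 + r) :=
          deriv_comp_const_add (fun y => G ξ.1 ξ.2.1 y ξ.2.2.2.1 ξ.2.2.2.2) ξ.2.2.1 r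
        rw [h5]; exact this)
      simpa using this
  simpa using key (t' - t) ht (x, y, t, p, q)

lemma exists_intVec {n : ℕ} (x : Euc n) : ∃ k : Fin n → ℤ, ‖x + intVec k‖ ≤ √n := by
  refine ⟨fun i => - ⌊x i⌋, ?_⟩
  rw [EuclideanSpace.norm_eq]
  refine Real.sqrt_le_sqrt ?_
  calc ∑ i, ‖(x + intVec fun i => - ⌊x i⌋) i‖ ^ 2 ≤ ∑ i : Fin n, (1:ℝ) := by
        refine Finset.sum_le_sum fun i _ => ?_
        have h0 : (x + intVec fun i => - ⌊x i⌋) i = Int.fract (x i) := by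
          simp only [intVec, PiLp.add_apply, Int.cast_neg]
          have := Int.self_sub_floor (x i); linarith
        rw [h0, Real.norm_eq_abs, abs_of_nonneg (Int.fract_nonneg _)]
        exact pow_le_one₀ (Int.fract_nonneg _) (Int.fract_lt_one _).le
    _ = n := by simp

lemma perY_int {n : ℕ} {G : Ham n} (h1 : HypH1 G) (j : ℤ) (x : Euc n) (y t : ℝ) (p : Euc n)
    (q : ℝ) : G x (y + j) t p q = G x y t p q := by
  have hp : Function.Periodic (fun y => G x y t p q) 1 := fun y => h1.2.2.1 x y t p q
  simpa using hp.int_mul j y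

lemma perT_int {n : ℕ} {G : Ham n} (h1 : HypH1 G) (j : ℤ) (x : Euc n) (y t : ℝ) (p : Euc n)
    (q : ℝ) : G x y (t + j) p q = G x y t p q := by
  have hp : Function.Periodic (fun t => G x y t p q) 1 := fun t => h1.2.2.2 x y t p q
  simpa using hp.int_mul j t

lemma fract_eq_add (y : ℝ) : ∃ j : ℤ, 0 ≤ y + j ∧ y + j ≤ 1 := by
  refine ⟨-⌊y⌋, ?_, ?_⟩
  · have := Int.fract_nonneg y; have h := Int.self_sub_floor y; push_cast
    linarith
  · have := (Int.fract_lt_one y).le; have h := Int.self_sub_floor y; push_cast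
    linarith

lemma modulus {n : ℕ} {G : Ham n} (h1 : HypH1 G) (K η : ℝ) (hη : 0 < η) :
    ∃ ρ > 0, ∀ (x x' : Euc n) (y t : ℝ) (p p' : Euc n) (q q' : ℝ), ‖p‖ ≤ K → |q| ≤ K →
      ‖x' - x‖ ≤ ρ → ‖p' - p‖ ≤ ρ → |q' - q| ≤ ρ → |G x' y t p' q' - G x y t p q| ≤ η := by
  have hc : IsCompact ((Metric.closedBall (0 : Euc n) (√n + 1)) ×ˢ (Set.Icc (0:ℝ) 1) ×ˢ
      (Set.Icc (0:ℝ) 1) ×ˢ (Metric.closedBall (0 : Euc n) (K + 1)) ×ˢ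
      (Metric.closedBall (0 : ℝ) (K + 1))) := by
    refine (isCompact_closedBall _ _).prod (isCompact_Icc.prod (isCompact_Icc.prod
      ((isCompact_closedBall _ _).prod (isCompact_closedBall _ _))))
  have hu := hc.uniformContinuousOn_of_continuous h1.1.continuousOn
  rw [Metric.uniformContinuousOn_iff] at hu
  obtain ⟨ρ, hρ, H⟩ := hu η hη
  refine ⟨min (ρ / 2) 1, by positivity, ?_⟩
  intro x x' y t p p' q q' hp hq hx hpp hqq
  obtain ⟨k, hk⟩ := exists_intVec x
  obtain ⟨j, hj⟩ := fract_eq_add y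
  obtain ⟨i, hi⟩ := fract_eq_add t
  rw [← h1.2.1 k x, ← h1.2.1 k x', ← perY_int h1 j, ← perY_int h1 j (x + intVec k),
    ← perT_int h1 i, ← perT_int h1 i (x + intVec k)]
  have m1 : min (ρ / 2) 1 ≤ 1 := min_le_right _ _
  have m2 : min (ρ / 2) 1 ≤ ρ / 2 := min_le_left _ _
  have hx2 : ‖x' + intVec k‖ ≤ √n + 1 := by
    calc ‖x' + intVec k‖ = ‖(x' - x) + (x + intVec k)‖ := by congr 1; abel
      _ ≤ ‖x' - x‖ + ‖x + intVec k‖ := norm_add_le _ _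
      _ ≤ _ := by linarith
  have hp2 : ‖p'‖ ≤ K + 1 := by
    calc ‖p'‖ = ‖(p' - p) + p‖ := by congr 1; abel
      _ ≤ ‖p' - p‖ + ‖p‖ := norm_add_le _ _
      _ ≤ _ := by linarith
  have hq2 : |q'| ≤ K + 1 := by
    calc |q'| = |(q' - q) + q| := by congr 1; ring
      _ ≤ |q' - q| + |q| := abs_add_le _ _
      _ ≤ _ := by linarith
  have := H (x' + intVec k, y + j, t + i, p', q') (by
      simp only [Set.mem_prod, Metric.mem_closedBall, dist_zero_right, Set.mem_Icc, Real.norm_eq_abs]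
      exact ⟨hx2, hj, hi, hp2, hq2⟩)
    (x + intVec k, y + j, t + i, p, q) (by
      simp only [Set.mem_prod, Metric.mem_closedBall, dist_zero_right, Set.mem_Icc, Real.norm_eq_abs]
      exact ⟨by linarith, hj, hi, by linarith, by linarith⟩) (by
      simp only [Prod.dist_eq, dist_self, dist_add_right, sup_lt_iff, hρ, true_and]
      rw [dist_eq_norm, dist_eq_norm, Real.dist_eq]
      refine ⟨by linarith, by linarith, by linarith⟩)
  rw [Real.dist_eq] at this
  exact this.le

lemma bddG0 {n : ℕ} {G : Ham n} (h1 : HypH1 G) :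
    ∃ M > 0, ∀ (x : Euc n) (y t : ℝ), |G x y t 0 0| ≤ M := by
  have hc : IsCompact ((Metric.closedBall (0 : Euc n) (√n)) ×ˢ (Set.Icc (0:ℝ) 1) ×ˢ
      (Set.Icc (0:ℝ) 1)) :=
    (isCompact_closedBall _ _).prod (isCompact_Icc.prod isCompact_Icc)
  have hcont : Continuous (fun z : Dom n => G z.1 z.2.1 z.2.2 0 0) :=
    h1.1.comp (f := fun z : Dom n => ((z.1, z.2.1, z.2.2, 0, 0) : Xi n)) (by fun_prop)
  obtain ⟨M, hM⟩ := hc.exists_bound_of_continuousOn hcont.continuousOn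
  refine ⟨max M 1, by positivity, fun x y t => ?_⟩
  obtain ⟨k, hk⟩ := exists_intVec x
  obtain ⟨j, hj⟩ := fract_eq_add y
  obtain ⟨i, hi⟩ := fract_eq_add t
  rw [← h1.2.1 k x, ← perY_int h1 j,  ← perT_int h1 i]
  have := hM (x + intVec k, y + j, t + i) (by
      simp only [Set.mem_prod, Metric.mem_closedBall, dist_zero_right, Set.mem_Icc]
      exact ⟨hk, hj, hi⟩)
  exact le_trans this (le_max_left _ _)


/-- The positive part squared. -/
def psq (s : ℝ) : ℝ := (max s 0) ^ 2

lemma hasDerivAt_psq (s : ℝ) : HasDerivAt psq (2 * max s 0) s := by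
  rcases lt_trichotomy s 0 with h | h | h
  · have : psq =ᶠ[𝓝 s] fun _ => 0 := by
      filter_upwards [Iio_mem_nhds h] with r hr
      simp only [Set.mem_Iio] at hr
      simp [psq, max_eq_right hr.le]
    rw [max_eq_right h.le, mul_zero]
    exact (hasDerivAt_const s (0:ℝ)).congr_of_eventuallyEq this
  · subst h
    simp only [max_self, mul_zero]
    rw [hasDerivAt_iff_isLittleO_nhds_zero]
    have h1 : (fun h : ℝ => psq (0 + h) - psq 0 - h • (0:ℝ)) =O[𝓝 0] (fun h : ℝ => h ^ 2) := by
      refine Asymptotics.isBigO_of_le _ fun r => ?_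
      simp only [psq, zero_add, smul_zero, sub_zero, max_self, Real.norm_eq_abs, abs_pow]
      norm_num
      rw [sq_le_sq]
      rcases le_total r 0 with hr | hr
      · simp [max_eq_right hr]
      · simp [max_eq_left hr]
    refine h1.trans_isLittleO ?_
    have := Asymptotics.isLittleO_pow_pow (𝕜 := ℝ) (m := 1) (n := 2) (by norm_num)
    simpa using this
  · have : psq =ᶠ[𝓝 s] fun r => r ^ 2 := by
      filter_upwards [Ioi_mem_nhds h] with r hr
      simp only [Set.mem_Ioi] at hr
      simp [psq, max_eq_left hr.le]
    rw [max_eq_left h.le]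
    have h2 : HasDerivAt (fun r : ℝ => r ^ 2) (2 * s) s := by
      simpa using hasDerivAt_pow 2 s
    exact h2.congr_of_eventuallyEq this

lemma contDiff_psq : ContDiff ℝ 1 psq := by
  rw [contDiff_one_iff_deriv]
  refine ⟨fun s => (hasDerivAt_psq s).differentiableAt, ?_⟩
  have : deriv psq = fun s => 2 * max s 0 := funext fun s => (hasDerivAt_psq s).deriv
  rw [this]; fun_prop

lemma psq_nonneg (s : ℝ) : 0 ≤ psq s := sq_nonneg _

/-- gradient bookkeeping -/
lemma pd_of_hasFDerivAt {n : ℕ} {φ : Dom n → ℝ} {z : Dom n} {L : Dom n →L[ℝ] ℝ}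
    (h : HasFDerivAt φ L z) (a : Euc n) (b c : ℝ)
    (hL : ∀ w : Dom n, L w = ⟪a, w.1⟫ + b * w.2.1 + c * w.2.2) :
    pdX φ z = a ∧ pdY φ z = b ∧ pdT φ z = c := by
  refine ⟨?_, ?_, ?_⟩
  · ext i
    simp [pdX, h.fderiv, hL, EuclideanSpace.inner_single_right]
  · simp [pdY, h.fderiv, hL]
  · simp [pdT, h.fderiv, hL]

/-- separable test functions -/
lemma pd_sep {n : ℕ} {A : Euc n → ℝ} {B D : ℝ → ℝ} {z : Dom n} {a : Euc n} {b c : ℝ}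
    (hA : HasFDerivAt A (innerSL ℝ a) z.1) (hB : HasDerivAt B b z.2.1) (hD : HasDerivAt D c z.2.2) :
    pdX (fun w : Dom n => A w.1 + B w.2.1 + D w.2.2) z = a ∧
    pdY (fun w : Dom n => A w.1 + B w.2.1 + D w.2.2) z = b ∧
    pdT (fun w : Dom n => A w.1 + B w.2.1 + D w.2.2) z = c := by
  have h1 : HasFDerivAt (fun w : Dom n => A w.1) _ z := hA.comp z (hasFDerivAt_fst)
  have h2 : HasFDerivAt (fun w : Dom n => B w.2.1) _ z :=
    hB.hasFDerivAt.comp z ((hasFDerivAt_fst).comp z hasFDerivAt_snd)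
  have h3 : HasFDerivAt (fun w : Dom n => D w.2.2) _ z :=
    hD.hasFDerivAt.comp z ((hasFDerivAt_snd).comp z hasFDerivAt_snd)
  refine pd_of_hasFDerivAt ((h1.add h2).add h3) a b c ?_
  intro w
  simp [mul_comm]

lemma hasFDerivAt_normsq {n : ℕ} (a : ℝ) (p x : Euc n) :
    HasFDerivAt (fun w : Euc n => a * ‖w - p‖ ^ 2) (innerSL ℝ ((2 * a) • (x - p))) x := by
  have h := ((hasFDerivAt_id x).sub_const p).norm_sq.const_mul a
  simp only [id] at h
  have he : innerSL ℝ ((2 * a) • (x - p)) =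
      a • 2 • (innerSL ℝ) (x - p) ∘SL ContinuousLinearMap.id ℝ (Euc n) := by
    ext w
    simp [inner_smul_left]; ring
  rw [he]; exact h

lemma contDiff_normsq {n : ℕ} (a : ℝ) (p : Euc n) :
    ContDiff ℝ 1 (fun w : Euc n => a * ‖w - p‖ ^ 2) :=
  contDiff_const.mul ((contDiff_id.sub contDiff_const).norm_sq ℝ)

lemma pd_add {n : ℕ} {φ ψ : Dom n → ℝ} {z : Dom n} (h1 : DifferentiableAt ℝ φ z)
    (h2 : DifferentiableAt ℝ ψ z) :
    pdX (fun w => φ w + ψ w) z = pdX φ z + pdX ψ z ∧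
    pdY (fun w => φ w + ψ w) z = pdY φ z + pdY ψ z ∧
    pdT (fun w => φ w + ψ w) z = pdT φ z + pdT ψ z := by
  have h : fderiv ℝ (fun w => φ w + ψ w) z = fderiv ℝ φ z + fderiv ℝ ψ z := fderiv_add h1 h2
  refine ⟨?_, by simp [pdY, h], by simp [pdT, h]⟩
  ext i; simp [pdX, h]

lemma pd_neg {n : ℕ} (φ : Dom n → ℝ) (z : Dom n)  :
    pdX (fun w => - φ w) z = - pdX φ z ∧ pdY (fun w => - φ w) z = - pdY φ z ∧
    pdT (fun w => - φ w) z = - pdT φ z := by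
  have h : fderiv ℝ (fun w => - φ w) z = - fderiv ℝ φ z := fderiv_neg
  refine ⟨?_, by simp [pdY, h], by simp [pdT, h]⟩
  ext i; simp [pdX, h]

lemma pd_continuous {n : ℕ} {φ : Dom n → ℝ} (h : ContDiff ℝ 1 φ) :
    Continuous (pdX φ) ∧ Continuous (pdY φ) ∧ Continuous (pdT φ) := by
  have hc : Continuous (fderiv ℝ φ) := h.continuous_fderiv (by norm_num)
  refine ⟨?_, ?_, ?_⟩
  · unfold pdX
    refine (PiLp.continuous_toLp 2 _).comp (continuous_pi fun i => ?_)
    exact hc.clm_apply continuous_const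
  · exact hc.clm_apply continuous_const
  · exact hc.clm_apply continuous_const

lemma extract_max {X : Type*} (f P Q N : X → ℝ) (hP : ∀ w, 0 ≤ P w) (hQ : ∀ w, 0 ≤ Q w)
    (hN : ∀ w, 0 ≤ N w) (B : ℝ) (hB : ∀ w, f w - P w ≤ B) (w0 : X) (hP0 : P w0 = 0)
    (hQ0 : Q w0 = 0) (κ : ℝ) (hκ : 0 < κ)
    (hmax : ∀ a c β : ℝ, 1 ≤ a → 1 ≤ c → 0 < β → ∃ w, ∀ w',
      f w' - c * P w' - a * Q w' - β * N w' ≤ f w - c * P w - a * Q w - β * N w) :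
    ∃ c : ℝ, 1 ≤ c ∧ ∃ a0 : ℝ, 1 ≤ a0 ∧ ∀ a, a0 ≤ a → ∃ β0 > 0, ∀ β, 0 < β → β ≤ β0 →
      ∃ w, (∀ w', f w' - c * P w' - a * Q w' - β * N w' ≤ f w - c * P w - a * Q w - β * N w) ∧
        c * P w ≤ 6 * κ ∧ a * Q w ≤ 6 * κ ∧ β * N w ≤ 3 * κ ∧
        f w0 - 2 * κ ≤ f w - c * P w - a * Q w := by
  have : Nonempty X := ⟨w0⟩
  set S : ℝ → ℝ → ℝ := fun a c => ⨆ w, (f w - c * P w - a * Q w) with hS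
  have hbdd : ∀ a c : ℝ, 1 ≤ a → 1 ≤ c → BddAbove (Set.range fun w => f w - c * P w - a * Q w) := by
    intro a c ha hc
    refine ⟨B, ?_⟩
    rintro _ ⟨w, rfl⟩
    have h1 := hB w
    have h2 := mul_le_mul_of_nonneg_right hc (hP w)
    have h3 : 0 ≤ a * Q w := mul_nonneg (by linarith) (hQ w)
    simp only
    linarith
  have hle : ∀ a c : ℝ, 1 ≤ a → 1 ≤ c → ∀ w, f w - c * P w - a * Q w ≤ S a c :=
    fun a c ha hc w => le_ciSup (hbdd a c ha hc) w
  set T : Set ℝ := {s | ∃ a c : ℝ, 1 ≤ a ∧ 1 ≤ c ∧ s = S a c} with hT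
  have hlow : ∀ s ∈ T, f w0 ≤ s := by
    rintro s ⟨a, c, ha, hc, rfl⟩
    have := hle a c ha hc w0
    simpa [hP0, hQ0] using this
  have hTne : T.Nonempty := ⟨S 1 1, 1, 1, le_rfl, le_rfl, rfl⟩
  have hTb : BddBelow T := ⟨f w0, hlow⟩
  have hS0 : f w0 ≤ sInf T := le_csInf hTne hlow
  obtain ⟨s, ⟨a1, c1, ha1, hc1, rfl⟩, hs⟩ := exists_lt_of_csInf_lt hTne
    (show sInf T < sInf T + κ by linarith)
  refine ⟨2 * c1, by linarith, 2 * a1, by linarith, fun a ha => ?_⟩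
  have hge : sInf T ≤ S a (2 * c1) := csInf_le hTb ⟨a, 2 * c1, by linarith, by linarith, rfl⟩
  obtain ⟨w1, hw1⟩ := exists_lt_of_lt_ciSup (show sInf T - κ < S a (2 * c1) by linarith)
  refine ⟨κ / (N w1 + 1), div_pos hκ (by linarith [hN w1]), fun β hβ hβ0 => ?_⟩
  obtain ⟨w, hw⟩ := hmax a (2 * c1) β (by linarith) (by linarith) hβ
  have hβ1 : β * N w1 ≤ κ := by
    rw [le_div_iff₀ (by linarith [hN w1])] at hβ0
    linarith
  have e1 := hw w1
  have e2 := hle a1 c1 ha1 hc1 w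
  have e3 : 0 ≤ β * N w := mul_nonneg hβ.le (hN w)
  have e4 : 2 * a1 * Q w ≤ a * Q w := mul_le_mul_of_nonneg_right ha (hQ w)
  have e5 : 0 ≤ c1 * P w := mul_nonneg (by linarith) (hP w)
  have e6 : 0 ≤ a * Q w := mul_nonneg (by linarith) (hQ w)
  refine ⟨w, hw, ?_, ?_, ?_, ?_⟩ <;> nlinarith

set_option maxHeartbeats 1000000 in
/-- Final bookkeeping at the maximum point. -/
lemma compare_point {n : ℕ} {G : Ham n} {C₁ C₂ l C₃ C₄ C₅ : ℝ} (h1 : HypH1 G)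
    (h2 : HypH2 G C₁ C₂) (h3 : HypH3 G l C₃ C₄ C₅) (α L1 L2 M s c K ρ r U V θ : ℝ) (hα : 0 ≤ α)
    (hs : 0 < s) (hs1 : s ≤ 1) (hsC : C₄ * s ≤ 1 / 2) (hc : 1 ≤ c)
    (hK : |l| + 2 * c ≤ K)
    (hK2 : (C₂ + C₅ * (|l| + 2 * c + 1) + |L2| + α * M + 2 * c + 1) / C₁ + 1 ≤ K)
    (hρ : 0 < ρ) (hρs : ρ ≤ s)
    (hmod : ∀ (x x' : Euc n) (y t : ℝ) (p p' : Euc n) (q q' : ℝ), ‖p‖ ≤ K → |q| ≤ K →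
      ‖x' - x‖ ≤ ρ → ‖p' - p‖ ≤ ρ → |q' - q| ≤ ρ → |G x' y t p' q' - G x y t p q| ≤ s)
    (x x' A bx bx' : Euc n) (y y' t t' q bY bY' bt bt' : ℝ)
    (hr0 : 0 ≤ r) (hr : c * r ^ 2 ≤ s ^ 2) (hτ : c * (t - t') ^ 2 ≤ s ^ 2)
    (hq : |q + l| = 2 * c * r) (hry : r * |y' - y| = r ^ 2)
    (hxx : ‖x' - x‖ ≤ ρ) (hbx : ‖bx‖ ≤ ρ) (hbx' : ‖bx'‖ ≤ ρ) (hby : |bY| ≤ ρ) (hby' : |bY'| ≤ ρ)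
    (hbt : |bt| ≤ ρ) (hbt' : |bt'| ≤ ρ)
    (hU : |U| ≤ M)
    (hsub : 2 * c * (t - t') + bt + G x y t (A + bx) (q + bY) + α * U ≤ L2)
    (hsup : L1 ≤ 2 * c * (t - t') - bt' + G x' y' t' (A - bx') (q - bY') + α * V)
    (hUV : θ - s - |l| * s ≤ U - V) :
    α * θ ≤ L2 - L1 + s * (4 + 2 * C₃ + 2 * C₄ * (1 + (1 + C₅) * (|l| + 2) +
      (|L2| + α * M + C₂ + 2) + 2) + α * (1 + |l|)) := by
  obtain ⟨hC1, hC2, hco⟩ := h2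
  have hC3 := h3.1
  have hC4 := h3.2.1
  have hC5 := h3.2.2.1
  have hs2 : s ^ 2 ≤ s := by nlinarith
  have hr1 : r ≤ s := by
    have : r ^ 2 ≤ s ^ 2 := by nlinarith [sq_nonneg r]
    exact abs_le_of_sq_le_sq' this hs.le |>.2
  have hτ1 : |t - t'| ≤ s := by
    have : (t - t') ^ 2 ≤ s ^ 2 := by nlinarith [sq_nonneg (t - t')]
    exact abs_le_of_sq_le_sq this hs.le
  have hτsq : |t - t'| ^ 2 = (t - t') ^ 2 := sq_abs _
  have hτ0 : 0 ≤ |t - t'| := abs_nonneg _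
  have hq1 : |q| ≤ |l| + 2 * c * r := by
    have : |q| ≤ |q + l| + |l| := by
      have := abs_sub (q + l) l; simpa using this
    linarith
  have hl0 : 0 ≤ |l| := abs_nonneg _
  have hq2 : |q| ≤ |l| + 2 * c := by
    have : c * r ≤ c * 1 := mul_le_mul_of_nonneg_left (hr1.trans hs1) (by linarith)
    linarith
  have hαU : |α * U| ≤ α * M := by rw [abs_mul, abs_of_nonneg hα]; gcongr
  obtain ⟨hαU1, hαU2⟩ := abs_le.1 hαU
  have hL2 : L2 ≤ |L2| := le_abs_self _
  have hL20 : 0 ≤ |L2| := abs_nonneg _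
  obtain ⟨hτ2, hτ3⟩ := abs_le.1 hτ1
  obtain ⟨hbt1, hbt2⟩ := abs_le.1 hbt
  obtain ⟨hbt1', hbt2'⟩ := abs_le.1 hbt'
  have hct : 2 * c * |t - t'| ≤ 2 * c := by
    have : c * |t - t'| ≤ c * 1 := mul_le_mul_of_nonneg_left (hτ1.trans hs1) (by linarith)
    linarith
  have hct2 : |2 * c * (t - t')| = 2 * c * |t - t'| := by
    rw [abs_mul, abs_of_nonneg (by linarith : 0 ≤ 2 * c)]
  obtain ⟨hct3, hct4⟩ := abs_le.1 hct2.le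
  -- lower bound of G
  have hlow : ∀ p' q', C₁ * ‖p'‖ - C₂ - C₅ * |q'| ≤ G x y t p' q' := by
    intro p' q'
    have e1 := hco x y t p'
    have e2 := lipQ h1 h3 x y t p' 0 q'
    rw [sub_zero] at e2
    have := (abs_le.1 e2).1
    linarith
  -- bound of A
  have hqbY : |q + bY| ≤ |l| + 2 * c + 1 := by
    have := abs_add_le q bY; linarith
  have hA1 : ‖A + bx‖ ≤ (C₂ + C₅ * (|l| + 2 * c + 1) + |L2| + α * M + 2 * c + 1) / C₁ := by
    rw [le_div_iff₀ hC1]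
    have e1 := hlow (A + bx) (q + bY)
    have e2 : C₅ * |q + bY| ≤ C₅ * (|l| + 2 * c + 1) := by gcongr
    linarith
  have hA : ‖A‖ ≤ K := by
    have : ‖A‖ ≤ ‖A + bx‖ + ‖bx‖ := by
      have := norm_sub_le (A + bx) bx; simpa using this
    linarith
  have hqK : |q| ≤ K := hq2.trans hK
  have m1 := hmod x x y t A (A + bx) q (q + bY) hA hqK (by simpa using hρ.le) (by simpa using hbx)
    (by simpa using hby)
  have m2 := hmod x x' y' t' A (A - bx') q (q - bY') hA hqK hxx (by simpa using hbx')
    (by simpa using hby')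
  have m3 := lipY h1 h3 x y y' t' A q
  have m4 := lipT h1 h3 x y t t' A q (by
    rw [abs_sub_comm]; exact (mul_le_mul_of_nonneg_left hτ1 hC4).trans hsC)
  rw [abs_sub_comm t' t] at m4
  set g := G x y t A q with hg
  have hgb : |g| ≤ (|L2| + α * M + C₂ + 2) + 2 * c * |t - t'| + C₅ * |q| := by
    have e1 := hlow A q
    have e2 := (abs_le.1 m1).1
    have e3 : 0 ≤ C₁ * ‖A‖ := by positivity
    have e4 : 0 ≤ C₅ * |q| := by positivity
    have e5 : 0 ≤ 2 * c * |t - t'| := by positivity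
    have e6 : 0 ≤ α * M := (abs_nonneg _).trans hαU
    rw [abs_le]; constructor <;> linarith
  have hM0 : 0 ≤ α * M := (abs_nonneg _).trans hαU
  have m3' : C₃ * |q + l| * |y' - y| ≤ 2 * C₃ * s := by
    have : C₃ * |q + l| * |y' - y| = 2 * C₃ * (c * r ^ 2) := by
      rw [hq, ← hry]; ring
    rw [this]
    have : C₃ * (c * r ^ 2) ≤ C₃ * s := mul_le_mul_of_nonneg_left (hr.trans hs2) hC3
    linarith
  have hτq : |t - t'| * |q| ≤ (|l| + 2) * s := by
    have e1 : |t - t'| * |q| ≤ |t - t'| * (|l| + 2 * c * r) := by gcongr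
    have e2 : 2 * (|t - t'| * r) ≤ |t - t'| ^ 2 + r ^ 2 := by
      nlinarith [sq_nonneg (|t - t'| - r)]
    have e3 : c * (2 * (|t - t'| * r)) ≤ c * (|t - t'| ^ 2 + r ^ 2) := by gcongr
    have e4 : |t - t'| * |l| ≤ s * |l| := by gcongr
    rw [hτsq] at e3
    linarith
  have m4' : |t - t'| * (1 + |q| + |g|) ≤ s * (1 + (1 + C₅) * (|l| + 2) +
      (|L2| + α * M + C₂ + 2) + 2) := by
    have e1 : |t - t'| * (1 + |q| + |g|) ≤ |t - t'| * (1 + |q| + ((|L2| + α * M + C₂ + 2) +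
      2 * c * |t - t'| + C₅ * |q|)) := by gcongr
    have e2 : |t - t'| * (1 + |q| + ((|L2| + α * M + C₂ + 2) + 2 * c * |t - t'| + C₅ * |q|)) =
      |t - t'| + (1 + C₅) * (|t - t'| * |q|) + |t - t'| * (|L2| + α * M + C₂ + 2) +
        2 * (c * (t - t') ^ 2) := by rw [← hτsq]; ring
    have e3 : (1 + C₅) * (|t - t'| * |q|) ≤ (1 + C₅) * ((|l| + 2) * s) := by gcongr
    have e4 : |t - t'| * (|L2| + α * M + C₂ + 2) ≤ s * (|L2| + α * M + C₂ + 2) := by gcongr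
    linarith
  have m4'' : 2 * C₄ * |t - t'| * (1 + |q| + |g|) ≤ 2 * C₄ * (s * (1 + (1 + C₅) * (|l| + 2) +
      (|L2| + α * M + C₂ + 2) + 2)) := by
    rw [mul_assoc (2 * C₄)]; gcongr
  have f1 := (abs_le.1 m1).1
  have f2 := (abs_le.1 m2).2
  have f3 := (abs_le.1 m3).2
  have f4 := (abs_le.1 m4).2
  have f5 : α * (θ - s - |l| * s) ≤ α * (U - V) := by gcongr
  linarith

lemma usc_neg {X : Type*} [TopologicalSpace X] {v : X → ℝ} (hv : LowerSemicontinuous v) :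
    UpperSemicontinuous (fun z => - v z) := by
  intro z c hc
  filter_upwards [hv z (-c) (by linarith)] with w hw
  linarith

lemma lsc_neg {X : Type*} [TopologicalSpace X] {v : X → ℝ} (hv : UpperSemicontinuous v) :
    LowerSemicontinuous (fun z => - v z) := by
  intro z c hc
  filter_upwards [hv z (-c) (by linarith)] with w hw
  linarith

lemma usc_exists_max {X : Type*} [NormedAddCommGroup X] [ProperSpace X] {F : X → ℝ}
    (hF : UpperSemicontinuous F) {B β : ℝ} (hβ : 0 < β) (hB : ∀ w, F w ≤ B - β * ‖w‖ ^ 2) :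
    ∃ w, ∀ w', F w' ≤ F w := by
  set R := max 1 ((B - F 0) / β) with hR
  have hR1 : 1 ≤ R := le_max_left _ _
  obtain ⟨w, hw, hmax⟩ := UpperSemicontinuousOn.exists_isMaxOn
    (s := Metric.closedBall (0:X) R) ⟨0, by simp; linarith⟩ (isCompact_closedBall _ _)
    (hF.upperSemicontinuousOn _)
  refine ⟨w, fun w' => ?_⟩
  by_cases h : w' ∈ Metric.closedBall (0:X) R
  · exact hmax h
  · have h0 : F 0 ≤ F w := hmax (by simp; linarith)
    have h1 : R < ‖w'‖ := by simpa using h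
    have h2 := hB w'
    have h3 : B - F 0 ≤ R * β := by
      rw [← div_le_iff₀ hβ]; exact le_max_right _ _
    have h4 : R ≤ ‖w'‖ ^ 2 := by nlinarith
    nlinarith

/-- squared size of a point -/
def nsq {n : ℕ} (z : Dom n) : ℝ := ‖z.1‖ ^ 2 + z.2.1 ^ 2 + z.2.2 ^ 2

lemma nsq_nonneg {n : ℕ} (z : Dom n) : 0 ≤ nsq z := by unfold nsq; positivity

lemma norm_sq_le_nsq {n : ℕ} (z : Dom n) : ‖z‖ ^ 2 ≤ nsq z := by
  unfold nsq
  have h1 : 0 ≤ ‖z.1‖ ^ 2 := by positivity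
  have h2 : 0 ≤ z.2.1 ^ 2 := by positivity
  have h3 : 0 ≤ z.2.2 ^ 2 := by positivity
  rw [Prod.norm_def]
  rcases max_choice ‖z.1‖ ‖z.2‖ with h | h <;> rw [h]
  · linarith
  · rw [Prod.norm_def]
    rcases max_choice ‖z.2.1‖ ‖z.2.2‖ with h | h <;> rw [h, Real.norm_eq_abs, sq_abs] <;> linarith

lemma continuous_nsq {n : ℕ} : Continuous (nsq (n := n)) := by unfold nsq; fun_prop

lemma continuous_psq : Continuous psq := contDiff_psq.continuous

lemma psq_eq_zero {s : ℝ} (h : s ≤ 0) : psq s = 0 := by simp [psq, max_eq_right h]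

/-- The doubled maximum point yields the two viscosity inequalities. -/
lemma doubling_ineq {n : ℕ} {G : Ham n} {l : ℝ} (α L1 L2 σ a c β : ℝ) (hσ : σ ^ 2 = 1)
    {u v : Dom n → ℝ} (hu : ViscSub G α L2 u) (hv : ViscSuper G α L1 v) (z z' : Dom n)
    (hmax : ∀ w w' : Dom n, u w - v w' - l * (w'.2.1 - w.2.1)
      - c * (psq (σ * (w.2.1 - w'.2.1)) + (w.2.2 - w'.2.2) ^ 2)
      - a * ‖w'.1 - w.1‖ ^ 2 - β * (nsq w + nsq w') ≤ u z - v z' - l * (z'.2.1 - z.2.1)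
      - c * (psq (σ * (z.2.1 - z'.2.1)) + (z.2.2 - z'.2.2) ^ 2)
      - a * ‖z'.1 - z.1‖ ^ 2 - β * (nsq z + nsq z')) :
    2 * c * (z.2.2 - z'.2.2) + 2 * β * z.2.2 + G z.1 z.2.1 z.2.2
      ((2 * a) • (z.1 - z'.1) + (2 * β) • z.1)
      (-l + 2 * c * σ * max (σ * (z.2.1 - z'.2.1)) 0 + 2 * β * z.2.1) + α * u z ≤ L2 ∧
    L1 ≤ 2 * c * (z.2.2 - z'.2.2) - 2 * β * z'.2.2 + G z'.1 z'.2.1 z'.2.2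
      ((2 * a) • (z.1 - z'.1) - (2 * β) • z'.1)
      (-l + 2 * c * σ * max (σ * (z.2.1 - z'.2.1)) 0 - 2 * β * z'.2.1) + α * v z' := by
  constructor
  · set A : Euc n → ℝ := fun x => a * ‖x - z'.1‖ ^ 2 + β * ‖x - 0‖ ^ 2 with hA
    set B : ℝ → ℝ := fun y => l * (z'.2.1 - y) + c * psq (σ * (y - z'.2.1)) + β * y ^ 2 with hB
    set D : ℝ → ℝ := fun t => c * (t - z'.2.2) ^ 2 + β * t ^ 2 with hD
    have dA : HasFDerivAt A (innerSL ℝ ((2 * a) • (z.1 - z'.1) + (2 * β) • z.1)) z.1 := by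
      have h := (hasFDerivAt_normsq a z'.1 z.1).add (hasFDerivAt_normsq β 0 z.1)
      rw [sub_zero, ← map_add] at h
      exact h
    have dB : HasDerivAt B
        (-l + 2 * c * σ * max (σ * (z.2.1 - z'.2.1)) 0 + 2 * β * z.2.1) z.2.1 := by
      have h1 : HasDerivAt (fun y : ℝ => l * (z'.2.1 - y)) (l * (-1)) z.2.1 :=
        ((hasDerivAt_id z.2.1).const_sub z'.2.1).const_mul l
      have h2 : HasDerivAt (fun y : ℝ => σ * (y - z'.2.1)) (σ * 1) z.2.1 :=
        ((hasDerivAt_id z.2.1).sub_const z'.2.1).const_mul σ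
      have h3 := ((hasDerivAt_psq (σ * (z.2.1 - z'.2.1))).comp z.2.1 h2).const_mul c
      have h4 : HasDerivAt (fun y : ℝ => β * y ^ 2) (β * (2 * z.2.1)) z.2.1 := by
        simpa using (hasDerivAt_pow 2 z.2.1).const_mul β
      exact ((h1.add h3).add h4).congr_deriv (by ring)
    have dD : HasDerivAt D (2 * c * (z.2.2 - z'.2.2) + 2 * β * z.2.2) z.2.2 := by
      have h3 : HasDerivAt (fun t : ℝ => c * (t - z'.2.2) ^ 2) (c * (2 * (z.2.2 - z'.2.2))) z.2.2 := by
        simpa using (((hasDerivAt_id z.2.2).sub_const z'.2.2).pow 2).const_mul c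
      have h4 : HasDerivAt (fun y : ℝ => β * y ^ 2) (β * (2 * z.2.2)) z.2.2 := by
        simpa using (hasDerivAt_pow 2 z.2.2).const_mul β
      exact (h3.add h4).congr_deriv (by ring)
    have cA : ContDiff ℝ 1 A := (contDiff_normsq a z'.1).add (contDiff_normsq β 0)
    have cB : ContDiff ℝ 1 B := by
      have : ContDiff ℝ 1 (fun y : ℝ => psq (σ * (y - z'.2.1))) :=
        contDiff_psq.comp (by fun_prop)
      fun_prop
    have cD : ContDiff ℝ 1 D := by fun_prop
    have hc : ContDiff ℝ 1 (fun w : Dom n => A w.1 + B w.2.1 + D w.2.2) := by fun_prop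
    have := hu.2 _ hc z (Filter.Eventually.of_forall fun w => by
      have h := hmax w z'
      simp only [hA, hB, hD, sub_zero]
      rw [norm_sub_rev z'.1 w.1, norm_sub_rev z'.1 z.1] at h
      unfold nsq at h
      linarith)
    obtain ⟨e1, e2, e3⟩ := pd_sep dA dB dD
    rwa [e1, e2, e3] at this
  · set A : Euc n → ℝ := fun x => (-a) * ‖x - z.1‖ ^ 2 + (-β) * ‖x - 0‖ ^ 2 with hA
    set B : ℝ → ℝ := fun y => -l * (y - z.2.1) - c * psq (σ * (z.2.1 - y)) - β * y ^ 2 with hB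
    set D : ℝ → ℝ := fun t => -c * (t - z.2.2) ^ 2 - β * t ^ 2 with hD
    have dA : HasFDerivAt A (innerSL ℝ ((2 * a) • (z.1 - z'.1) - (2 * β) • z'.1)) z'.1 := by
      have h := (hasFDerivAt_normsq (-a) z.1 z'.1).add (hasFDerivAt_normsq (-β) 0 z'.1)
      rw [sub_zero, ← map_add] at h
      have he : (2 * a) • (z.1 - z'.1) - (2 * β) • z'.1
          = (2 * -a) • (z'.1 - z.1) + (2 * -β) • z'.1 := by module
      rw [he]; exact h
    have dB : HasDerivAt B
        (-l + 2 * c * σ * max (σ * (z.2.1 - z'.2.1)) 0 - 2 * β * z'.2.1) z'.2.1 := by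
      have h1 : HasDerivAt (fun y : ℝ => -l * (y - z.2.1)) (-l * 1) z'.2.1 :=
        ((hasDerivAt_id z'.2.1).sub_const z.2.1).const_mul (-l)
      have h2 : HasDerivAt (fun y : ℝ => σ * (z.2.1 - y)) (σ * (-1)) z'.2.1 :=
        ((hasDerivAt_id z'.2.1).const_sub z.2.1).const_mul σ
      have h3 := ((hasDerivAt_psq (σ * (z.2.1 - z'.2.1))).comp z'.2.1 h2).const_mul c
      have h4 : HasDerivAt (fun y : ℝ => β * y ^ 2) (β * (2 * z'.2.1)) z'.2.1 := by
        simpa using (hasDerivAt_pow 2 z'.2.1).const_mul β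
      exact ((h1.sub h3).sub h4).congr_deriv (by ring)
    have dD : HasDerivAt D (2 * c * (z.2.2 - z'.2.2) - 2 * β * z'.2.2) z'.2.2 := by
      have h3 : HasDerivAt (fun t : ℝ => -c * (t - z.2.2) ^ 2) (-c * (2 * (z'.2.2 - z.2.2)))
          z'.2.2 := by
        simpa using (((hasDerivAt_id z'.2.2).sub_const z.2.2).pow 2).const_mul (-c)
      have h4 : HasDerivAt (fun y : ℝ => β * y ^ 2) (β * (2 * z'.2.2)) z'.2.2 := by
        simpa using (hasDerivAt_pow 2 z'.2.2).const_mul β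
      exact (h3.sub h4).congr_deriv (by ring)
    have cA : ContDiff ℝ 1 A := (contDiff_normsq (-a) z.1).add (contDiff_normsq (-β) 0)
    have cB : ContDiff ℝ 1 B := by
      have : ContDiff ℝ 1 (fun y : ℝ => psq (σ * (z.2.1 - y))) :=
        contDiff_psq.comp (by fun_prop)
      fun_prop
    have cD : ContDiff ℝ 1 D := by fun_prop
    have hc : ContDiff ℝ 1 (fun w : Dom n => A w.1 + B w.2.1 + D w.2.2) := by fun_prop
    have := hv.2 _ hc z' (Filter.Eventually.of_forall fun w => by
      have h := hmax z w
      simp only [hA, hB, hD, sub_zero]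
      unfold nsq at h
      linarith)
    obtain ⟨e1, e2, e3⟩ := pd_sep dA dB dD
    rwa [e1, e2, e3] at this

lemma small_of_sq {β ρ s N b : ℝ} (hρ : 0 < ρ) (hβ : 0 < β) (hβ1 : β ≤ ρ ^ 2 / 4) (hs1 : s ≤ 1)
    (hs0 : 0 < s)
    (hN : β * N ≤ s ^ 2) (hb0 : 0 ≤ b) (hb : b ^ 2 ≤ N) : 2 * β * b ≤ ρ := by
  have h1 : β * b ^ 2 ≤ 1 := by nlinarith
  have h2 : (2 * β * b) ^ 2 ≤ ρ ^ 2 := by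
    have : (2 * β * b) ^ 2 = 4 * β * (β * b ^ 2) := by ring
    rw [this]; nlinarith
  exact (abs_le_of_sq_le_sq' h2 hρ.le).2

set_option maxHeartbeats 1000000 in
theorem compare {n : ℕ} {G : Ham n} {C₁ C₂ l C₃ C₄ C₅ : ℝ} (h1 : HypH1 G)
    (h2 : HypH2 G C₁ C₂) (h3 : HypH3 G l C₃ C₄ C₅) {α L1 L2 σ : ℝ} (hα : 0 ≤ α)
    (hσ : σ ^ 2 = 1) (hσl : 0 ≤ σ * l) {u v : Dom n → ℝ} (hub : Bdd u) (hvb : Bdd v)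
    (hu : ViscSub G α L2 u) (hv : ViscSuper G α L1 v) (x : Euc n) (y y' t : ℝ)
    (hy : 0 ≤ σ * (y' - y)) :
    α * (u (x, y, t) - v (x, y', t) - l * (y' - y)) ≤ L2 - L1 := by
  obtain ⟨M, hM⟩ := hub
  obtain ⟨M', hM'⟩ := hvb
  have hlσ : σ * l = |l| := by
    rw [← abs_of_nonneg hσl, abs_mul]
    have : |σ| = 1 := by
      have := sq_abs σ; rw [hσ] at this
      nlinarith only [abs_nonneg σ, this]
    rw [this, one_mul]
  -- key sign estimate
  have hsign : ∀ Y Y' : ℝ, -(|l| * max (σ * (Y - Y')) 0) ≤ l * (Y' - Y) := by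
    intro Y Y'
    have e1 : l * (Y' - Y) = - ((σ * l) * (σ * (Y - Y'))) := by
      have : (σ * l) * (σ * (Y - Y')) = σ ^ 2 * (l * (Y - Y')) := by ring
      rw [this, hσ]; ring
    rw [e1, hlσ]
    have : |l| * (σ * (Y - Y')) ≤ |l| * max (σ * (Y - Y')) 0 :=
      mul_le_mul_of_nonneg_left (le_max_left _ _) (abs_nonneg _)
    linarith
  set θ := u (x, y, t) - v (x, y', t) - l * (y' - y) with hθ
  set E := (4 + 2 * C₃ + 2 * C₄ * (1 + (1 + C₅) * (|l| + 2) +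
      (|L2| + α * M + C₂ + 2) + 2) + α * (1 + |l|)) with hE
  have hC4 := h3.2.1
  have main : ∀ s : ℝ, 0 < s → s ≤ 1 → C₄ * s ≤ 1 / 2 → α * θ ≤ L2 - L1 + s * E := by
    intro s hs hs1 hsC
    have hss : s ^ 2 ≤ s := by nlinarith only [hs, hs1]
    have hss0 : 0 ≤ s ^ 2 := sq_nonneg s
    set f : Dom n × Dom n → ℝ := fun w => u w.1 - v w.2 - l * (w.2.2.1 - w.1.2.1) with hf
    set P : Dom n × Dom n → ℝ := fun w =>
      psq (σ * (w.1.2.1 - w.2.2.1)) + (w.1.2.2 - w.2.2.2) ^ 2 with hPdef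
    set Q : Dom n × Dom n → ℝ := fun w => ‖w.2.1 - w.1.1‖ ^ 2 with hQdef
    set N : Dom n × Dom n → ℝ := fun w => nsq w.1 + nsq w.2 with hNdef
    have hP : ∀ w, 0 ≤ P w := fun w => add_nonneg (psq_nonneg _) (sq_nonneg _)
    have hQ : ∀ w, 0 ≤ Q w := fun w => sq_nonneg _
    have hN : ∀ w, 0 ≤ N w := fun w => add_nonneg (nsq_nonneg _) (nsq_nonneg _)
    have hB : ∀ w, f w - P w ≤ M + M' + l ^ 2 := by
      intro w
      have e1 := hsign w.1.2.1 w.2.2.1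
      have e2 := (abs_le.1 (hM w.1)).2
      have e3 := (abs_le.1 (hM' w.2)).1
      have e4 : |l| * max (σ * (w.1.2.1 - w.2.2.1)) 0 ≤ l ^ 2 + psq (σ * (w.1.2.1 - w.2.2.1)) := by
        unfold psq
        rw [← sq_abs l]
        nlinarith [sq_nonneg (|l| - max (σ * (w.1.2.1 - w.2.2.1)) 0), sq_nonneg |l|,
          sq_nonneg (max (σ * (w.1.2.1 - w.2.2.1)) 0)]
      have e5 := sq_nonneg (w.1.2.2 - w.2.2.2)
      simp only [hf, hPdef]
      linarith
    have hmax : ∀ a c β : ℝ, 1 ≤ a → 1 ≤ c → 0 < β → ∃ w, ∀ w',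
      f w' - c * P w' - a * Q w' - β * N w' ≤ f w - c * P w - a * Q w - β * N w := by
      intro a c β ha hc hβ
      refine usc_exists_max (F := fun w => f w - c * P w - a * Q w - β * N w) ?_
        (B := M + M' + l ^ 2) hβ ?_
      · have c1 : Continuous (fun w : Dom n × Dom n => - l * (w.2.2.1 - w.1.2.1) - c * P w
            - a * Q w - β * N w) := by
          have hp : Continuous P :=
            (continuous_psq.comp (by fun_prop)).add (by fun_prop)
          have hq : Continuous Q := by fun_prop
          have hn : Continuous N :=
            (continuous_nsq.comp continuous_fst).add (continuous_nsq.comp continuous_snd)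
          fun_prop
        have u1 : UpperSemicontinuous (fun w : Dom n × Dom n => u w.1) :=
          hu.1.comp continuous_fst
        have u2 : UpperSemicontinuous (fun w : Dom n × Dom n => - v w.2) :=
          (usc_neg hv.1).comp continuous_snd
        have := (u1.add u2).add c1.upperSemicontinuous
        have e : (fun w => f w - c * P w - a * Q w - β * N w) = fun w : Dom n × Dom n =>
            u w.1 + -v w.2 + (- l * (w.2.2.1 - w.1.2.1) - c * P w - a * Q w - β * N w) := by
          funext w
          have : f w = u w.1 - v w.2 - l * (w.2.2.1 - w.1.2.1) := rfl
          rw [this]; ring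
        rw [e]; exact this
      · intro w
        have e1 := hB w
        have e2 : 1 * P w ≤ c * P w := mul_le_mul_of_nonneg_right hc (hP w)
        have e3 : 0 ≤ a * Q w := mul_nonneg (by linarith) (hQ w)
        have e4 : ‖w‖ ^ 2 ≤ N w := by
          rw [Prod.norm_def]
          have a1 := norm_sq_le_nsq w.1
          have a2 := norm_sq_le_nsq w.2
          have a3 := nsq_nonneg w.1
          have a4 := nsq_nonneg w.2
          simp only [hNdef]
          rcases max_choice ‖w.1‖ ‖w.2‖ with h | h <;> rw [h] <;> linarith
        have e5 : β * ‖w‖ ^ 2 ≤ β * N w := mul_le_mul_of_nonneg_left e4 hβ.le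
        linarith
    obtain ⟨c, hc, a0, ha0, H⟩ := extract_max f P Q N hP hQ hN _ hB ((x, y, t), (x, y', t))
      (by
        simp only [hPdef, sub_self]
        rw [psq_eq_zero (by linarith [hy, (by ring : σ * (y - y') = -(σ * (y' - y)))])]
        norm_num) (by simp [hQdef]) (s ^ 2 / 6) (by positivity) hmax
    set K := max (|l| + 2 * c)
      ((C₂ + C₅ * (|l| + 2 * c + 1) + |L2| + α * M + 2 * c + 1) / C₁ + 1) with hK
    obtain ⟨ρ0, hρ0, hmod0⟩ := modulus h1 K s hs
    set ρ := min ρ0 s with hρdef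
    have hρ : 0 < ρ := lt_min hρ0 hs
    have hρs : ρ ≤ s := min_le_right _ _
    have hρρ : ρ ≤ ρ0 := min_le_left _ _
    set a := max a0 (1 / ρ ^ 2) with ha
    obtain ⟨β0, hβ0, H2⟩ := H a (le_max_left _ _)
    set β := min β0 (ρ ^ 2 / 4) with hβ
    have hβpos : 0 < β := lt_min hβ0 (by positivity)
    obtain ⟨⟨z, z'⟩, w1, w2, w3, w4, w5⟩ := H2 β hβpos (min_le_left _ _)
    obtain ⟨d1, d2⟩ := doubling_ineq (l := l) α L1 L2 σ a c β hσ hu hv z z'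
      (fun w w' => w1 (w, w'))
    set r := max (σ * (z.2.1 - z'.2.1)) 0 with hr
    have hr0 : 0 ≤ r := le_max_right _ _
    have hcP : c * P (z, z') = c * r ^ 2 + c * (z.2.2 - z'.2.2) ^ 2 := by
      simp only [hPdef, psq]; ring
    have q1 : 0 ≤ c * r ^ 2 := by positivity
    have q2 : 0 ≤ c * (z.2.2 - z'.2.2) ^ 2 := by positivity
    have hr2 : c * r ^ 2 ≤ s ^ 2 := by linarith
    have hrs : r ≤ s := by
      have : r ^ 2 ≤ s ^ 2 := by nlinarith only [sq_nonneg r, hc, hr2]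
      exact abs_le_of_sq_le_sq' this hs.le |>.2
    have hβN : β * N (z, z') ≤ s ^ 2 := by linarith
    have hσabs : |σ| = 1 := by
      have := sq_abs σ; rw [hσ] at this
      nlinarith only [abs_nonneg σ, this]
    have hNz : N (z, z') = ‖z.1‖ ^ 2 + z.2.1 ^ 2 + z.2.2 ^ 2 +
      (‖z'.1‖ ^ 2 + z'.2.1 ^ 2 + z'.2.2 ^ 2) := rfl
    have n1 := sq_nonneg ‖z.1‖
    have n2 := sq_nonneg z.2.1
    have n3 := sq_nonneg z.2.2
    have n4 := sq_nonneg ‖z'.1‖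
    have n5 := sq_nonneg z'.2.1
    have n6 := sq_nonneg z'.2.2
    have hsm : ∀ b : ℝ, 0 ≤ b → b ^ 2 ≤ N (z, z') → 2 * β * b ≤ ρ := fun b hb0 hb =>
      small_of_sq hρ hβpos (min_le_right _ _) hs1 hs hβN hb0 hb
    have hsma : ∀ b : ℝ, b ^ 2 ≤ N (z, z') → |2 * β * b| ≤ ρ := fun b hb => by
      rw [abs_mul, abs_of_nonneg (by positivity : 0 ≤ 2 * β)]
      exact hsm |b| (abs_nonneg _) (by rwa [sq_abs])
    have hsmv : ∀ b : Euc n, ‖b‖ ^ 2 ≤ N (z, z') → ‖(2 * β) • b‖ ≤ ρ := fun b hb => by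
      rw [norm_smul, Real.norm_eq_abs, abs_of_nonneg (by positivity : 0 ≤ 2 * β)]
      exact hsm ‖b‖ (norm_nonneg _) hb
    refine compare_point h1 h2 h3 α L1 L2 M s c K ρ r (u z) (v z') θ hα hs hs1 hsC hc
      (le_max_left _ _) (le_max_right _ _) hρ hρs
      (fun x x' y t p p' q q' g1 g2 g3 g4 g5 => hmod0 x x' y t p p' q q' g1 g2 (g3.trans hρρ)
        (g4.trans hρρ) (g5.trans hρρ)) z.1 z'.1 ((2 * a) • (z.1 - z'.1)) ((2 * β) • z.1)
        ((2 * β) • z'.1) z.2.1 z'.2.1 z.2.2 z'.2.2 (-l + 2 * c * σ * r) (2 * β * z.2.1)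
        (2 * β * z'.2.1) (2 * β * z.2.2) (2 * β * z'.2.2) hr0 hr2 (by linarith) ?_ ?_ ?_
        (hsmv _ (by linarith)) (hsmv _ (by linarith)) (hsma _ (by linarith))
        (hsma _ (by linarith)) (hsma _ (by linarith)) (hsma _ (by linarith)) (hM z) d1 d2 ?_
    · have : -l + 2 * c * σ * r + l = σ * (2 * c * r) := by ring
      rw [this, abs_mul, hσabs, one_mul, abs_of_nonneg (by positivity)]
    · rcases le_total (σ * (z.2.1 - z'.2.1)) 0 with h | h
      · have : r = 0 := max_eq_right h
        rw [this]; ring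
      · have e : r = σ * (z.2.1 - z'.2.1) := max_eq_left h
        have : |z'.2.1 - z.2.1| = r := by
          rw [abs_sub_comm, e, ← abs_of_nonneg h, abs_mul, hσabs, one_mul]
        rw [this]; ring
    · have hQz : a * ‖z'.1 - z.1‖ ^ 2 ≤ s ^ 2 := by
        have : a * Q (z, z') = a * ‖z'.1 - z.1‖ ^ 2 := rfl
        linarith
      have ha1 : 1 / ρ ^ 2 ≤ a := le_max_right _ _
      have e1 : 1 ≤ a * ρ ^ 2 := by
        rw [div_le_iff₀ (by positivity)] at ha1; exact ha1
      have ha0' : 0 < a := lt_of_lt_of_le (by positivity) ha1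
      have e2 : a * ‖z'.1 - z.1‖ ^ 2 ≤ a * ρ ^ 2 := by linarith [hss, hs1, hQz, e1]
      have e3 : ‖z'.1 - z.1‖ ^ 2 ≤ ρ ^ 2 := le_of_mul_le_mul_left e2 ha0'
      exact (abs_le_of_sq_le_sq' e3 hρ.le).2
    · have e1 := hsign z.2.1 z'.2.1
      have e2 : 0 ≤ c * P (z, z') := by rw [hcP]; positivity
      have e3 : 0 ≤ a * Q (z, z') :=
        mul_nonneg (by linarith [le_max_left a0 (1 / ρ ^ 2)]) (hQ _)
      have e4 : |l| * r ≤ |l| * s := mul_le_mul_of_nonneg_left hrs (abs_nonneg _)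
      have e5 : f ((x, y, t), (x, y', t)) = θ := rfl
      have e6 : f (z, z') = u z - v z' - l * (z'.2.1 - z.2.1) := rfl
      rw [e5, e6] at w5
      linarith [hss]
  -- let s → 0
  by_contra hcon
  push Not at hcon
  set gap := α * θ - (L2 - L1) with hgap
  have hg : 0 < gap := by linarith
  set s := min (min 1 (1 / (2 * (C₄ + 1)))) (gap / (2 * (|E| + 1))) with hs
  have hs0 : 0 < s := by
    refine lt_min (lt_min one_pos (by positivity)) (by positivity)
  have hs1 : s ≤ 1 := (min_le_left _ _).trans (min_le_left _ _)
  have hs2 : s ≤ 1 / (2 * (C₄ + 1)) := (min_le_left _ _).trans (min_le_right _ _)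
  have hs3 : s ≤ gap / (2 * (|E| + 1)) := min_le_right _ _
  have := main s hs0 hs1 (by
    rw [le_div_iff₀ (by positivity)] at hs2; nlinarith)
  rw [le_div_iff₀ (by positivity)] at hs3
  have h5 : s * E ≤ s * |E| := mul_le_mul_of_nonneg_left (le_abs_self _) hs0.le
  nlinarith

/-- The continuity part of (H1). -/
abbrev HamCont {n : ℕ} (G : Ham n) : Prop :=
  Continuous (fun ξ : Xi n => G ξ.1 ξ.2.1 ξ.2.2.1 ξ.2.2.2.1 ξ.2.2.2.2)

/-- The dual Hamiltonian. -/
def dualH {n : ℕ} (G : Ham n) : Ham n := fun x y t p q => - G x y t (-p) (-q)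

lemma dualH_cont {n : ℕ} {G : Ham n} (h : HamCont G) : HamCont (dualH G) := by
  unfold dualH
  exact (h.comp (f := fun ξ : Xi n => ((ξ.1, ξ.2.1, ξ.2.2.1, -ξ.2.2.2.1, -ξ.2.2.2.2) : Xi n))
    (by fun_prop)).neg

lemma super_to_sub {n : ℕ} {G : Ham n} {α lam : ℝ} {v : Dom n → ℝ} (hv : ViscSuper G α lam v) :
    ViscSub (dualH G) α (-lam) (fun z => - v z) := by
  refine ⟨usc_neg hv.1, fun φ hφ z hz => ?_⟩
  have := hv.2 (fun w => - φ w) hφ.neg z (by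
    filter_upwards [hz] with w hw
    linarith)
  obtain ⟨e1, e2, e3⟩ := pd_neg φ z
  rw [e1, e2, e3] at this
  unfold dualH
  linarith

lemma sub_to_super {n : ℕ} {G : Ham n} {α lam : ℝ} {v : Dom n → ℝ}
    (hv : ViscSub (dualH G) α (-lam) v) :
    ViscSuper G α lam (fun z => - v z) := by
  refine ⟨lsc_neg hv.1, fun φ hφ z hz => ?_⟩
  have := hv.2 (fun w => - φ w) hφ.neg z (by
    filter_upwards [hz] with w hw
    linarith)
  obtain ⟨e1, e2, e3⟩ := pd_neg φ z
  rw [e1, e2, e3] at this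
  unfold dualH at this
  rw [neg_neg, neg_neg] at this
  linarith

lemma contDiff_nsq {n : ℕ} (z : Dom n) : ContDiff ℝ 1 (fun w : Dom n => nsq (w - z)) := by
  unfold nsq
  have h : ContDiff ℝ 1 (fun w : Dom n => ‖(w - z).1‖ ^ 2) :=
    ContDiff.norm_sq ℝ (by fun_prop)
  have h2 : ContDiff ℝ 1 (fun w : Dom n => (w - z).2.1 ^ 2) := by fun_prop
  have h3 : ContDiff ℝ 1 (fun w : Dom n => (w - z).2.2 ^ 2) := by fun_prop
  exact (h.add h2).add h3

lemma pd_nsq {n : ℕ} (b : ℝ) (z : Dom n) : pdX (fun w : Dom n => b * nsq (w - z)) z = 0 ∧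
    pdY (fun w : Dom n => b * nsq (w - z)) z = 0 ∧ pdT (fun w : Dom n => b * nsq (w - z)) z = 0 := by
  have dA := hasFDerivAt_normsq b z.1 z.1
  have dB : ∀ c : ℝ, HasDerivAt (fun y : ℝ => b * (y - c) ^ 2) 0 c := by
    intro c
    simpa using (((hasDerivAt_id c).sub_const c).pow 2).const_mul b
  rw [sub_self, smul_zero] at dA
  have := pd_sep dA (dB z.2.1) (dB z.2.2)
  have e : (fun w : Dom n => b * nsq (w - z)) = fun w : Dom n =>
    b * ‖w.1 - z.1‖ ^ 2 + b * (w.2.1 - z.2.1) ^ 2 + b * (w.2.2 - z.2.2) ^ 2 := by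
    funext w; simp only [nsq, Prod.fst_sub, Prod.snd_sub]; ring
  rw [e]; exact this

/-- The test function perturbed by a multiple of the squared distance. -/
lemma pert {n : ℕ} {φ : Dom n → ℝ} (hφ : ContDiff ℝ 1 φ) (b : ℝ) (z : Dom n) :
    ContDiff ℝ 1 (fun w => φ w + b * nsq (w - z)) ∧
    pdX (fun w => φ w + b * nsq (w - z)) z = pdX φ z ∧
    pdY (fun w => φ w + b * nsq (w - z)) z = pdY φ z ∧
    pdT (fun w => φ w + b * nsq (w - z)) z = pdT φ z := by
  have hc : ContDiff ℝ 1 (fun w : Dom n => b * nsq (w - z)) := contDiff_const.mul (contDiff_nsq z)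
  obtain ⟨e1, e2, e3⟩ := pd_nsq b z
  obtain ⟨f1, f2, f3⟩ := pd_add (z := z) (hφ.differentiable (by norm_num) z)
    (hc.differentiable (by norm_num) z)
  refine ⟨hφ.add hc, ?_, ?_, ?_⟩
  · rw [f1, e1, add_zero]
  · rw [f2, e2, add_zero]
  · rw [f3, e3, add_zero]

/-- Continuity of the operator along a test function. -/
lemma op_continuous {n : ℕ} {G : Ham n} (hG : HamCont G) {φ : Dom n → ℝ} (hφ : ContDiff ℝ 1 φ) :
    Continuous (fun w : Dom n => pdT φ w + G w.1 w.2.1 w.2.2 (pdX φ w) (pdY φ w)) := by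
  obtain ⟨c1, c2, c3⟩ := pd_continuous hφ
  refine c3.add (hG.comp (f := fun w : Dom n => ((w.1, w.2.1, w.2.2, pdX φ w, pdY φ w) : Xi n)) ?_)
  fun_prop

/-- relaxed upper limit, as a predicate -/
structure IsRelSup {n : ℕ} {I : Type*} (F : Filter I) (u : I → Dom n → ℝ) (U : Dom n → ℝ) :
    Prop where
  up : ∀ z c, U z < c → ∀ᶠ p in F ×ˢ 𝓝 z, u p.1 p.2 < c
  low : ∀ z c, c < U z → ∃ᶠ p in F ×ˢ 𝓝 z, c < u p.1 p.2

lemma exists_relSup {n : ℕ} {I : Type*} (F : Filter I) [F.NeBot] (u : I → Dom n → ℝ) (M : ℝ)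
    (hM : ∀ i z, |u i z| ≤ M) : ∃ U : Dom n → ℝ, IsRelSup F u U ∧ ∀ z, |U z| ≤ M := by
  have hb : ∀ z : Dom n, IsBoundedUnder (· ≤ ·) (F ×ˢ 𝓝 z) (fun p => u p.1 p.2) := fun z =>
    isBoundedUnder_of ⟨M, fun p => (abs_le.1 (hM _ _)).2⟩
  have hb' : ∀ z : Dom n, IsBoundedUnder (· ≥ ·) (F ×ˢ 𝓝 z) (fun p => u p.1 p.2) := fun z =>
    isBoundedUnder_of ⟨-M, fun p => (abs_le.1 (hM _ _)).1⟩
  refine ⟨fun z => limsup (fun p => u p.1 p.2) (F ×ˢ 𝓝 z), ⟨?_, ?_⟩, ?_⟩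
  · intro z c hc
    exact eventually_lt_of_limsup_lt hc (hb z)
  · intro z c hc
    exact frequently_lt_of_lt_limsup ((hb' z).isCoboundedUnder_le) hc
  · intro z
    rw [abs_le]
    constructor
    · refine le_limsup_of_frequently_le ?_ (hb z)
      exact Filter.Frequently.of_forall fun p => (abs_le.1 (hM _ _)).1
    · refine limsup_le_of_le ((hb' z).isCoboundedUnder_le) ?_
      exact Filter.Eventually.of_forall fun p => (abs_le.1 (hM _ _)).2

lemma IsRelSup.usc {n : ℕ} {I : Type*} {F : Filter I} {u : I → Dom n → ℝ} {U : Dom n → ℝ}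
    (h : IsRelSup F u U) : UpperSemicontinuous U := by
  intro z c hc
  obtain ⟨d, hd1, hd2⟩ := exists_between hc
  have := h.up z d hd1
  obtain ⟨A, hA, B, hB, hAB⟩ := Filter.mem_prod_iff.1 this
  filter_upwards [eventually_mem_nhds_iff.2 hB] with w hw
  by_contra hcon
  push Not at hcon
  have hf := h.low w d (lt_of_lt_of_le hd2 hcon)
  have he : ∀ᶠ p in F ×ˢ 𝓝 w, u p.1 p.2 < d := Filter.mem_prod_iff.2 ⟨A, hA, B, hw, hAB⟩
  obtain ⟨p, hp1, hp2⟩ := (hf.and_eventually he).exists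
  linarith

lemma sq_le_nsq_of_le {n : ℕ} {w z : Dom n} : dist w z ^ 2 ≤ nsq (w - z) := by
  rw [dist_eq_norm]; exact norm_sq_le_nsq _

lemma nsq_zero {n : ℕ} (z : Dom n) : nsq (z - z) = 0 := by simp [nsq]

theorem stability {n : ℕ} {I : Type*} {F : Filter I} {G : Ham n} (hG : HamCont G)
    {u : I → Dom n → ℝ} {U : Dom n → ℝ} (hU : IsRelSup F u U) {α lam : ℝ} (hα : 0 ≤ α)
    {L : I → ℝ} (hL : Tendsto L F (𝓝 lam)) (hu : ∀ i, ViscSub G α (L i) (u i)) :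
    ViscSub G α lam U := by
  refine ⟨hU.usc, fun φ hφ z hz => ?_⟩
  by_contra hcon
  push Not at hcon
  obtain ⟨hψ, e1, e2, e3⟩ := pert hφ 1 z
  set ψ : Dom n → ℝ := fun w => φ w + 1 * nsq (w - z) with hψdef
  have hψz : ψ z = φ z := by
    change φ z + 1 * nsq (z - z) = φ z
    rw [nsq_zero]; ring
  set H : Dom n → ℝ := fun w => pdT ψ w + G w.1 w.2.1 w.2.2 (pdX ψ w) (pdY ψ w) with hH
  have hHc : Continuous H := op_continuous hG hψ
  have hHz : lam < H z + α * U z := by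
    simp only [hH]; rw [e1, e2, e3]; exact hcon
  -- margins
  obtain ⟨η, hη, hη1⟩ : ∃ η > 0, lam + 2 * η < H z + α * U z :=
    ⟨(H z + α * U z - lam) / 3, by linarith, by linarith⟩
  obtain ⟨δ, hδ, hδ1⟩ : ∃ δ > 0, α * δ ≤ η / 2 := by
    refine ⟨η / 2 / (α + 1), by positivity, ?_⟩
    rw [mul_div_assoc', div_le_iff₀ (by positivity)]
    nlinarith
  have ev1 : ∀ᶠ w in 𝓝 z, H z - η / 2 < H w := hHc.continuousAt.eventually_const_lt (by linarith)
  have ev2 : ∀ᶠ w in 𝓝 z, φ z - δ / 2 < ψ w :=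
    hψ.continuous.continuousAt.eventually_const_lt (by linarith)
  obtain ⟨r, hr, hball⟩ := Metric.nhds_basis_closedBall.mem_iff.1 ((ev1.and ev2).and hz)
  set ε := min (δ / 2) (r ^ 2 / 2) with hε
  have hε0 : 0 < ε := by positivity
  -- on the sphere
  have hsph : ∀ᶠ i in F, ∀ w ∈ Metric.sphere z r, u i w - ψ w < U z - φ z - r ^ 2 / 2 := by
    have hK : IsCompact (Metric.sphere z r) := isCompact_sphere z r
    have := hK.mem_prod_nhdsSet_of_forall (l := F)
      (s := {p : I × Dom n | u p.1 p.2 - ψ p.2 < U z - φ z - r ^ 2 / 2}) (fun w hw => by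
        have h1 : U w - φ w ≤ U z - φ z := (hball (Metric.sphere_subset_closedBall hw)).2
        have h2 : r ^ 2 ≤ nsq (w - z) := by
          have := sq_le_nsq_of_le (w := w) (z := z)
          rwa [Metric.mem_sphere.1 hw] at this
        have h3 : U w < ψ w + (U z - φ z - r ^ 2 / 2) - r ^ 2 / 4 := by
          have : ψ w = φ w + 1 * nsq (w - z) := rfl
          have hr2 : 0 < r ^ 2 := by positivity
          linarith
        have h4 := hU.up w _ h3
        have h5 : ∀ᶠ p : I × Dom n in F ×ˢ 𝓝 w, ψ w - r ^ 2 / 4 < ψ p.2 :=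
          tendsto_snd.eventually (hψ.continuous.continuousAt.eventually_const_lt (by
            have hr2 : 0 < r ^ 2 := by positivity
            linarith))
        filter_upwards [h4, h5] with p hp1 hp2
        show u p.1 p.2 - ψ p.2 < U z - φ z - r ^ 2 / 2
        linarith)
    have h6 := Filter.Eventually.curry (la := F) (lb := 𝓝ˢ (Metric.sphere z r)) this
    filter_upwards [h6] with i hi w hw
    exact hi.self_of_nhdsSet w hw
  have hLi : ∀ᶠ i in F, L i < lam + η := hL.eventually_lt_const (by linarith)
  have hfr := hU.low z (U z - ε / 2) (by linarith)
  have ev3 : ∀ᶠ w in 𝓝 z, ψ w < φ z + ε / 2 :=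
    hψ.continuous.continuousAt.eventually_lt_const (by linarith)
  have ev4 : ∀ᶠ w in 𝓝 z, w ∈ Metric.closedBall z r := Metric.closedBall_mem_nhds z hr
  obtain ⟨⟨i, w0⟩, ⟨hp1, hp2⟩, hp3, hp4⟩ := ((hfr.and_eventually
    (tendsto_fst.eventually (hsph.and hLi))).and_eventually
      (tendsto_snd.eventually (ev3.and ev4))).exists
  simp only at hp1 hp2 hp3 hp4
  obtain ⟨w, hw, hmax⟩ := UpperSemicontinuousOn.exists_isMaxOn
    (s := Metric.closedBall z r) (f := fun w => u i w - ψ w) ⟨w0, hp4⟩ (isCompact_closedBall _ _)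
    (by
      have := (hu i).1.add hψ.continuous.neg.upperSemicontinuous
      exact (by simpa [sub_eq_add_neg] using this :
        UpperSemicontinuous fun w => u i w - ψ w).upperSemicontinuousOn _)
  have hge : U z - φ z - ε < u i w - ψ w := by
    have : u i w0 - ψ w0 ≤ u i w - ψ w := hmax hp4
    linarith
  have hnot : w ∉ Metric.sphere z r := fun hs => by
    have := hp2.1 w hs
    have := min_le_right (δ / 2) (r ^ 2 / 2)
    linarith
  have hin : w ∈ Metric.ball z r := by
    rw [Metric.mem_ball]
    exact lt_of_le_of_ne hw hnot
  have hloc : IsLocalMax (fun w => u i w - ψ w) w := by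
    filter_upwards [Metric.isOpen_ball.mem_nhds hin] with w' hw'
    exact hmax (Metric.ball_subset_closedBall hw')
  have h7 := (hu i).2 ψ hψ w hloc
  obtain ⟨⟨h8, h9⟩, -⟩ := hball hw
  have h10 : U z - δ ≤ u i w := by
    have := min_le_left (δ / 2) (r ^ 2 / 2)
    linarith
  have h11 : α * (U z - δ) ≤ α * u i w := mul_le_mul_of_nonneg_left h10 hα
  have h12 : H w + α * u i w ≤ L i := h7
  have := hp2.2
  linarith [mul_sub α (U z) δ]

/-- Uniqueness of the ergodic constant. -/
theorem ergodic_le {n : ℕ} {G : Ham n} {C₁ C₂ l C₃ C₄ C₅ : ℝ} (h1 : HypH1 G)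
    (h2 : HypH2 G C₁ C₂) (h3 : HypH3 G l C₃ C₄ C₅) {L1 L2 : ℝ} (e1 : ErgodicConst G L1)
    (e2 : ErgodicConst G L2) : L1 ≤ L2 := by
  obtain ⟨-, v, hvb, hv⟩ := e1
  obtain ⟨⟨u, hub, hu⟩, -⟩ := e2
  have key : ∀ σ : ℝ, σ ^ 2 = 1 → 0 ≤ σ * l → L1 ≤ L2 := fun σ hσ hσl => by
    have := compare h1 h2 h3 le_rfl hσ hσl hub hvb hu hv 0 0 0 0 (by simp)
    linarith
  rcases le_total 0 l with h | h
  · exact key 1 (by norm_num) (by linarith)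
  · exact key (-1) (by norm_num) (by linarith)

lemma pd_eq_of_fderiv {n : ℕ} {φ ψ : Dom n → ℝ} {z z' : Dom n}
    (h : fderiv ℝ φ z = fderiv ℝ ψ z') : pdX φ z = pdX ψ z' ∧ pdY φ z = pdY ψ z' ∧
    pdT φ z = pdT ψ z' := by
  simp [pdX, pdY, pdT, h]

lemma pd_zero_of_fderiv {n : ℕ} {φ : Dom n → ℝ} {z : Dom n}
    (h : fderiv ℝ φ z = 0) : pdX φ z = 0 ∧ pdY φ z = 0 ∧ pdT φ z = 0 := by
  refine ⟨?_, by simp [pdY, h], by simp [pdT, h]⟩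
  ext i; simp [pdX, h]

lemma visc_translate {n : ℕ} {G : Ham n} {α lam : ℝ} {u : Dom n → ℝ} (τ : Dom n)
    (hτ : ∀ (z : Dom n) p q, G (z + τ).1 (z + τ).2.1 (z + τ).2.2 p q = G z.1 z.2.1 z.2.2 p q)
    (hu : ViscSub G α lam u) : ViscSub G α lam (fun z => u (z + τ)) := by
  refine ⟨hu.1.comp (by fun_prop : Continuous fun z : Dom n => z + τ), fun φ hφ z hz => ?_⟩
  have hc : ContDiff ℝ 1 (fun w : Dom n => φ (w - τ)) := hφ.comp (by fun_prop)
  have hloc : IsLocalMax (fun w => u w - φ (w - τ)) (z + τ) := by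
    have ht : Tendsto (fun w : Dom n => w - τ) (𝓝 (z + τ)) (𝓝 z) := by
      have : Continuous (fun w : Dom n => w - τ) := by fun_prop
      simpa using this.tendsto (z + τ)
    filter_upwards [ht.eventually hz] with w hw
    simpa using hw
  have h := hu.2 _ hc (z + τ) hloc
  have hf : fderiv ℝ (fun w : Dom n => φ (w - τ)) (z + τ) = fderiv ℝ φ z := by
    rw [fderiv_comp_sub]; simp
  obtain ⟨e1, e2, e3⟩ := pd_eq_of_fderiv hf
  rw [e1, e2, e3, hτ] at h
  exact h

/-- The Perron class. -/
def PClass {n : ℕ} (G : Ham n) (α C : ℝ) : Set (Dom n → ℝ) :=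
  {u | ViscSub G α 0 u ∧ ∀ z, |u z| ≤ C}

lemma perron_max {n : ℕ} {G : Ham n} (hG : HamCont G) {α C M₀ : ℝ} (hα : 0 < α)
    (hM : ∀ (x : Euc n) (y t : ℝ), |G x y t 0 0| ≤ M₀) (hC : α * C = M₀) :
    ∃ w ∈ PClass G α C, ∀ u ∈ PClass G α C, ∀ z, u z ≤ w z := by
  have hM0 : 0 ≤ M₀ := (abs_nonneg _).trans (hM 0 0 0)
  have hC0 : 0 ≤ C := by
    by_contra h
    push Not at h
    nlinarith
  have hmem : (fun _ : Dom n => -C) ∈ PClass G α C := by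
    refine ⟨⟨upperSemicontinuous_const, fun φ hφ z hz => ?_⟩, fun z => by
      rw [abs_neg, abs_of_nonneg hC0]⟩
    have hloc : IsLocalMin φ z := by
      filter_upwards [hz] with w hw
      linarith
    obtain ⟨e1, e2, e3⟩ := pd_zero_of_fderiv hloc.fderiv_eq_zero
    rw [e1, e2, e3]
    have := (abs_le.1 (hM z.1 z.2.1 z.2.2)).2
    linarith
  have : Nonempty (PClass G α C) := ⟨⟨_, hmem⟩⟩
  obtain ⟨U, hU, hUb⟩ := exists_relSup (⊤ : Filter (PClass G α C)) (fun i => i.1) C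
    (fun i z => i.2.2 z)
  refine ⟨U, ⟨stability hG hU hα.le (L := fun _ => 0) tendsto_const_nhds (fun i => i.2.1), hUb⟩, ?_⟩
  intro u hu z
  by_contra hcon
  push Not at hcon
  have := hU.up z _ hcon
  obtain ⟨A, hA, B, hB, hAB⟩ := Filter.mem_prod_iff.1 this
  rw [mem_top] at hA
  have h : ((⟨u, hu⟩ : PClass G α C), z) ∈ A ×ˢ B := ⟨hA ▸ Set.mem_univ _, mem_of_mem_nhds hB⟩
  exact lt_irrefl (u z) (hAB h)

lemma perron_bump {n : ℕ} {G : Ham n} {α C r κ : ℝ} (hr : 0 < r)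
    (hκ : κ < r ^ 2 / 4) {w ψ : Dom n → ℝ} (hw : w ∈ PClass G α C) (hψ : ContDiff ℝ 1 ψ)
    (z : Dom n) (h1 : ∀ z' ∈ Metric.closedBall z r, ψ z' + κ ≤ C)
    (h2 : ∀ z' ∈ Metric.closedBall z r, pdT ψ z' + G z'.1 z'.2.1 z'.2.2 (pdX ψ z') (pdY ψ z')
      + α * (ψ z' + κ) ≤ 0)
    (h3 : ∀ z' ∈ Metric.closedBall z r, ψ z' + nsq (z' - z) ≤ w z') :
    ∃ U ∈ PClass G α C, ∀ z' ∈ Metric.closedBall z r, ψ z' + κ ≤ U z' := by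
  classical
  set U : Dom n → ℝ := fun z' => if z' ∈ Metric.closedBall z r then max (w z') (ψ z' + κ) else w z'
    with hU
  have hUin : ∀ z' ∈ Metric.closedBall z r, U z' = max (w z') (ψ z' + κ) := fun z' h => if_pos h
  have hUout : ∀ z', r / 2 < dist z' z → U z' = w z' := by
    intro z' h
    by_cases hz : z' ∈ Metric.closedBall z r
    · rw [hUin z' hz]
      apply max_eq_left
      have a1 := h3 z' hz
      have a2 := sq_le_nsq_of_le (w := z') (z := z)
      have a3 : (r / 2) ^ 2 ≤ dist z' z ^ 2 := pow_le_pow_left₀ (by positivity) h.le 2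
      linarith [(by ring : (r / 2) ^ 2 = r ^ 2 / 4)]
    · exact if_neg hz
  have hUge : ∀ z', w z' ≤ U z' := by
    intro z'
    by_cases hz : z' ∈ Metric.closedBall z r
    · rw [hUin z' hz]; exact le_max_left _ _
    · exact (if_neg hz).symm.le
  have hcase : ∀ z', (∀ᶠ z'' in 𝓝 z', U z'' = w z'') ∨ (∀ᶠ z'' in 𝓝 z', z'' ∈ Metric.closedBall z r) := by
    intro z'
    rcases lt_or_ge (r / 2) (dist z' z) with h | h
    · left
      have hc : Continuous (fun z'' : Dom n => dist z'' z) := by fun_prop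
      filter_upwards [hc.continuousAt.eventually_const_lt h] with z'' h''
      exact hUout z'' h''
    · right
      have : z' ∈ Metric.ball z r := by rw [Metric.mem_ball]; linarith
      filter_upwards [Metric.isOpen_ball.mem_nhds this] with z'' h''
      exact Metric.ball_subset_closedBall h''
  refine ⟨U, ⟨⟨?_, ?_⟩, ?_⟩, fun z' hz => by rw [hUin z' hz]; exact le_max_right _ _⟩
  · intro z' c hc
    rcases hcase z' with h | h
    · rw [h.self_of_nhds] at hc
      filter_upwards [h, hw.1.1 z' c hc] with z'' e1 e2
      rwa [e1]
    · rw [hUin z' h.self_of_nhds, max_lt_iff] at hc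
      have hcont : Continuous (fun z => ψ z + κ) := hψ.continuous.add continuous_const
      filter_upwards [h, hw.1.1 z' c hc.1,
        hcont.continuousAt.eventually_lt_const hc.2] with z'' e1 e2 e3
      rw [hUin z'' e1, max_lt_iff]
      exact ⟨e2, e3⟩
  · intro φ hφ z' hz'
    by_cases heq : U z' = w z'
    · have hloc : IsLocalMax (fun w' => w w' - φ w') z' := by
        filter_upwards [hz'] with z'' h''
        have := hUge z''
        linarith
      have := hw.1.2 φ hφ z' hloc
      rwa [heq]
    · have hb : ∀ᶠ z'' in 𝓝 z', z'' ∈ Metric.closedBall z r := by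
        rcases hcase z' with h | h
        · exact absurd h.self_of_nhds heq
        · exact h
      have hz0 := hb.self_of_nhds
      have hUz : U z' = ψ z' + κ := by
        rw [hUin z' hz0] at heq ⊢
        rcases max_choice (w z') (ψ z' + κ) with h | h
        · exact absurd h heq
        · exact h
      have hloc : IsLocalMax (fun w' => ψ w' - φ w') z' := by
        filter_upwards [hz', hb] with z'' h'' hb''
        have : ψ z'' + κ ≤ U z'' := by rw [hUin z'' hb'']; exact le_max_right _ _
        linarith
      have hd := hloc.fderiv_eq_zero
      have hs : fderiv ℝ (fun w' => ψ w' - φ w') z' = fderiv ℝ ψ z' - fderiv ℝ φ z' :=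
        fderiv_sub (hψ.differentiable (by norm_num) z') (hφ.differentiable (by norm_num) z')
      rw [hs, sub_eq_zero] at hd
      obtain ⟨e1, e2, e3⟩ := pd_eq_of_fderiv hd
      rw [← e1, ← e2, ← e3, hUz]
      exact h2 z' hz0
  · intro z'
    rw [abs_le]
    have a := abs_le.1 (hw.2 z')
    refine ⟨a.1.trans (hUge z'), ?_⟩
    by_cases hz : z' ∈ Metric.closedBall z r
    · rw [hUin z' hz]
      exact max_le a.2 (h1 z' hz)
    · have : U z' = w z' := if_neg hz
      rw [this]; exact a.2

lemma perron_super {n : ℕ} {G : Ham n} (hG : HamCont G) {α C M₀ : ℝ} (hα : 0 < α)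
    (hM : ∀ (x : Euc n) (y t : ℝ), |G x y t 0 0| ≤ M₀) (hC : α * C = M₀) {w : Dom n → ℝ}
    (hw : w ∈ PClass G α C) (hmax : ∀ u ∈ PClass G α C, ∀ z, u z ≤ w z) :
    ∃ v : Dom n → ℝ, ViscSuper G α 0 v ∧ (∀ z, v z ≤ w z) ∧ ∀ z, |v z| ≤ C := by
  obtain ⟨V, hV, hVb⟩ := exists_relSup (⊤ : Filter Unit) (fun _ z => - w z) C
    (fun i z => by rw [abs_neg]; exact hw.2 z)
  have hvw : ∀ z, - V z ≤ w z := by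
    intro z
    by_contra hcon
    push Not at hcon
    have := hV.up z (- w z) (by linarith)
    obtain ⟨A, hA, B, hB, hAB⟩ := Filter.mem_prod_iff.1 this
    rw [mem_top] at hA
    have h : ((), z) ∈ A ×ˢ B := ⟨hA ▸ Set.mem_univ _, mem_of_mem_nhds hB⟩
    exact lt_irrefl (- w z) (hAB h)
  refine ⟨fun z => - V z, ⟨lsc_neg hV.usc, fun φ hφ z hz => ?_⟩, hvw, fun z => by
    rw [abs_neg]; exact hVb z⟩
  by_contra hcon
  push Not at hcon
  have hVlt : - V z < C := by
    have h0 : - V z ≤ C := by have := (abs_le.1 (hVb z)).1; linarith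
    rcases h0.lt_or_eq with h | h
    · exact h
    · exfalso
      have hloc : IsLocalMax φ z := by
        filter_upwards [hz] with z' hz'
        have := (abs_le.1 (hVb z')).1
        linarith
      obtain ⟨e1, e2, e3⟩ := pd_zero_of_fderiv hloc.fderiv_eq_zero
      rw [e1, e2, e3, h, hC] at hcon
      have := (abs_le.1 (hM z.1 z.2.1 z.2.2)).1
      linarith
  -- test function
  have hφ2 : ContDiff ℝ 1 (fun w' => φ w' + (- V z - φ z)) := hφ.add contDiff_const
  obtain ⟨hψ, e1, e2, e3⟩ := pert hφ2 (-1) z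
  have hfd : fderiv ℝ (fun w' => φ w' + (- V z - φ z)) z = fderiv ℝ φ z := fderiv_add_const _
  obtain ⟨f1, f2, f3⟩ := pd_eq_of_fderiv hfd
  rw [f1] at e1
  rw [f2] at e2
  rw [f3] at e3
  set ψ : Dom n → ℝ := fun w' => φ w' + (- V z - φ z) + -1 * nsq (w' - z) with hψdef
  have hψe : ∀ z', ψ z' = φ z' + (- V z - φ z) + -1 * nsq (z' - z) := fun _ => rfl
  have hψz : ψ z = - V z := by
    rw [hψe, nsq_zero]; ring
  set H : Dom n → ℝ := fun w => pdT ψ w + G w.1 w.2.1 w.2.2 (pdX ψ w) (pdY ψ w) with hH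
  have hHc : Continuous H := op_continuous hG hψ
  have hHz : H z + α * ψ z < 0 := by
    simp only [hH]; rw [e1, e2, e3, hψz]; exact hcon
  obtain ⟨η, hη, hη1⟩ : ∃ η > 0, H z + α * ψ z + η < 0 :=
    ⟨-(H z + α * ψ z) / 2, by linarith, by linarith⟩
  have hc1 : Continuous (fun w => H w + α * ψ w + η) := by
    have := hψ.continuous
    fun_prop
  have ev1 : ∀ᶠ z' in 𝓝 z, H z' + α * ψ z' + η < 0 := hc1.continuousAt.eventually_lt_const hη1
  obtain ⟨d, hd1, hd2⟩ := exists_between hVlt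
  have ev2 : ∀ᶠ z' in 𝓝 z, ψ z' < d :=
    hψ.continuous.continuousAt.eventually_lt_const (by rwa [hψz])
  obtain ⟨r, hr, hball⟩ := Metric.nhds_basis_closedBall.mem_iff.1 ((ev1.and ev2).and hz)
  set κ := min (min (η / α) (C - d)) (r ^ 2 / 8) with hκdef
  have hκ0 : 0 < κ := by
    refine lt_min (lt_min (by positivity) (by linarith)) (by positivity)
  have hκ1 : α * κ ≤ η := by
    have : κ ≤ η / α := (min_le_left _ _).trans (min_le_left _ _)
    rw [le_div_iff₀ hα] at this
    linarith
  have hκ2 : κ ≤ C - d := (min_le_left _ _).trans (min_le_right _ _)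
  have hκ3 : κ < r ^ 2 / 4 := by
    have : κ ≤ r ^ 2 / 8 := min_le_right _ _
    have : 0 < r ^ 2 := by positivity
    linarith
  obtain ⟨U, hU, hU2⟩ := perron_bump hr hκ3 hw hψ z
    (fun z' hz' => by
      have : ψ z' < d := (hball hz').1.2
      linarith)
    (fun z' hz' => by
      have : H z' + α * ψ z' + η < 0 := (hball hz').1.1
      have h2 : H z' + α * (ψ z' + κ) ≤ 0 := by linarith [mul_add α (ψ z') κ]
      exact h2)
    (fun z' hz' => by
      have : - V z - φ z ≤ - V z' - φ z' := (hball hz').2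
      have h2 := hvw z'
      rw [hψe]
      linarith)
  have hfr := hV.low z (V z - κ / 2) (by linarith)
  have ev3 : ∀ᶠ z' in 𝓝 z, - V z - κ / 2 < ψ z' :=
    hψ.continuous.continuousAt.eventually_const_lt (by rw [hψz]; linarith)
  have ev4 : ∀ᶠ w in 𝓝 z, w ∈ Metric.closedBall z r := Metric.closedBall_mem_nhds z hr
  obtain ⟨⟨i, z'⟩, hp1, hp3, hp4⟩ := (hfr.and_eventually
      (tendsto_snd.eventually (ev3.and ev4))).exists
  have b1 := hU2 z' hp4
  have b2 := hmax U hU z'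
  simp only at hp1 hp3
  linarith

lemma exists_sigma (l : ℝ) : ∃ σ : ℝ, σ ^ 2 = 1 ∧ 0 ≤ σ * l ∧ |σ| = 1 ∧ (σ = 1 ∨ σ = -1) := by
  rcases le_total 0 l with h | h
  · exact ⟨1, by norm_num, by linarith, by norm_num, Or.inl rfl⟩
  · exact ⟨-1, by norm_num, by linarith, by norm_num, Or.inr rfl⟩

theorem perron {n : ℕ} {G : Ham n} {C₁ C₂ l C₃ C₄ C₅ M₀ : ℝ} (h1 : HypH1 G)
    (h2 : HypH2 G C₁ C₂) (h3 : HypH3 G l C₃ C₄ C₅) {α : ℝ} (hα : 0 < α)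
    (hM : ∀ (x : Euc n) (y t : ℝ), |G x y t 0 0| ≤ M₀) :
    ∃ w : Dom n → ℝ, Continuous w ∧ ViscSub G α 0 w ∧ ViscSuper G α 0 w ∧
      (∀ z, |α * w z| ≤ M₀) ∧ STPeriodic w ∧ ∀ x y y' t, w (x, y, t) ≤ w (x, y', t) + |l| := by
  have hC : α * (M₀ / α) = M₀ := by field_simp
  obtain ⟨w, hw, hmax⟩ := perron_max h1.1 hα hM hC
  obtain ⟨v, hv, hvw, hvb⟩ := perron_super h1.1 hα hM hC hw hmax
  obtain ⟨σ, hσ, hσl, hσ1, hσc⟩ := exists_sigma l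
  have hcmp : ∀ x y y' t, 0 ≤ σ * (y' - y) → w (x, y, t) ≤ v (x, y', t) + l * (y' - y) := by
    intro x y y' t hy
    have := compare h1 h2 h3 hα.le hσ hσl ⟨_, hw.2⟩ ⟨_, hvb⟩ hw.1 hv x y y' t hy
    rw [sub_self] at this
    have := nonpos_of_mul_nonpos_right this hα
    linarith
  have hvweq : v = w := by
    funext z
    refine le_antisymm (hvw z) ?_
    have := hcmp z.1 z.2.1 z.2.1 z.2.2 (by simp)
    simpa using this
  subst hvweq
  have htr : ∀ τ : Dom n, (∀ (z : Dom n) p q, G (z + τ).1 (z + τ).2.1 (z + τ).2.2 p q =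
      G z.1 z.2.1 z.2.2 p q) → ∀ z, v (z + τ) = v z := by
    intro τ hτ
    have key : ∀ τ : Dom n, (∀ (z : Dom n) p q, G (z + τ).1 (z + τ).2.1 (z + τ).2.2 p q =
      G z.1 z.2.1 z.2.2 p q) → ∀ z, v (z + τ) ≤ v z := fun τ hτ z =>
      hmax (fun z => v (z + τ)) ⟨visc_translate τ hτ hw.1, fun z => hw.2 _⟩ z
    intro z
    refine le_antisymm (key τ hτ z) ?_
    have := key (-τ) (fun z p q => by
      have := hτ (z + -τ) p q
      rw [neg_add_cancel_right] at this
      exact this.symm) (z + τ)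
    rwa [add_neg_cancel_right] at this
  have hper : STPeriodic v := by
    refine ⟨fun k x y t => ?_, fun x y t => ?_, fun x y t => ?_⟩
    · have := htr (intVec k, 0, 0) (fun z p q => by simpa using h1.2.1 k z.1 z.2.1 z.2.2 p q) (x, y, t)
      simpa using this
    · have := htr (0, 1, 0) (fun z p q => by simpa using h1.2.2.1 z.1 z.2.1 z.2.2 p q) (x, y, t)
      simpa using this
    · have := htr (0, 0, 1) (fun z p q => by simpa using h1.2.2.2 z.1 z.2.1 z.2.2 p q) (x, y, t)
      simpa using this
  have hperY : ∀ (j : ℤ) x y t, v (x, y + j, t) = v (x, y, t) := fun j x y t => by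
    have hp : Function.Periodic (fun y => v (x, y, t)) 1 := fun y => hper.2.1 x y t
    simpa using hp.int_mul j y
  refine ⟨v, continuous_iff_lower_upperSemicontinuous.2 ⟨hv.1, hw.1.1⟩, hw.1, hv, ?_, hper, ?_⟩
  · intro z
    rw [abs_mul, abs_of_pos hα]
    calc α * |v z| ≤ α * (M₀ / α) := mul_le_mul_of_nonneg_left (hw.2 z) hα.le
      _ = M₀ := hC
  · intro x y y' t
    have : ∃ j : ℤ, 0 ≤ σ * (y' + j - y) ∧ |y' + j - y| ≤ 1 := by
      rcases hσc with h | h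
      · obtain ⟨j, hj1, hj2⟩ := fract_eq_add (y' - y)
        refine ⟨j, by rw [h]; linarith, by rw [abs_le]; constructor <;> linarith⟩
      · obtain ⟨j, hj1, hj2⟩ := fract_eq_add (y - y')
        refine ⟨-j, by rw [h]; push_cast; linarith, by
          rw [abs_le]; push_cast; constructor <;> linarith⟩
    obtain ⟨j, hj1, hj2⟩ := this
    have h := hcmp x y (y' + j) t hj1
    rw [hperY] at h
    have : l * (y' + j - y) ≤ |l| * 1 := by
      refine (le_abs_self _).trans ?_
      rw [abs_mul]
      exact mul_le_mul_of_nonneg_left hj2 (abs_nonneg _)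
    linarith

/-- The barrier. -/
def barr {n : ℕ} (A c L N r C₁ : ℝ) (x0 : Euc n) (t0 t1 : ℝ) (w : Dom n) : ℝ :=
  A + c * (w.2.2 - t0) + L * psq (‖w.1 - x0‖ ^ 2 - (r + C₁ * (w.2.2 - t0)) ^ 2) +
    N * psq (w.2.2 - t1)

lemma barr_contDiff {n : ℕ} (A c L N r C₁ : ℝ) (x0 : Euc n) (t0 t1 : ℝ) :
    ContDiff ℝ 1 (barr A c L N r C₁ x0 t0 t1) := by
  unfold barr
  have h1 : ContDiff ℝ 1 (fun w : Dom n => ‖w.1 - x0‖ ^ 2) := ContDiff.norm_sq ℝ (by fun_prop)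
  have h2 : ContDiff ℝ 1 (fun w : Dom n => psq (‖w.1 - x0‖ ^ 2 - (r + C₁ * (w.2.2 - t0)) ^ 2)) :=
    contDiff_psq.comp (by fun_prop)
  have h3 : ContDiff ℝ 1 (fun w : Dom n => psq (w.2.2 - t1)) :=
    contDiff_psq.comp (by fun_prop)
  fun_prop

lemma barr_pd {n : ℕ} (A c L N r C₁ : ℝ) (x0 : Euc n) (t0 t1 : ℝ) (z : Dom n) :
    let m := max (‖z.1 - x0‖ ^ 2 - (r + C₁ * (z.2.2 - t0)) ^ 2) 0
    pdX (barr A c L N r C₁ x0 t0 t1) z = (4 * L * m) • (z.1 - x0) ∧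
    pdY (barr A c L N r C₁ x0 t0 t1) z = 0 ∧
    pdT (barr A c L N r C₁ x0 t0 t1) z =
      c - 4 * L * m * C₁ * (r + C₁ * (z.2.2 - t0)) + 2 * N * max (z.2.2 - t1) 0 := by
  intro m
  have hx : HasFDerivAt (fun w : Dom n => ‖w.1 - x0‖ ^ 2) _ z :=
    ((hasFDerivAt_fst (𝕜 := ℝ) (p := z)).sub_const x0).norm_sq
  have ht : HasFDerivAt (fun w : Dom n => w.2.2) _ z :=
    (hasFDerivAt_snd (𝕜 := ℝ) (p := z.2)).comp z (hasFDerivAt_snd (𝕜 := ℝ) (p := z))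
  have hρ : HasFDerivAt (fun w : Dom n => r + C₁ * (w.2.2 - t0)) _ z :=
    ((ht.sub_const t0).const_mul C₁).const_add r
  have hg : HasFDerivAt (fun w : Dom n => ‖w.1 - x0‖ ^ 2 - (r + C₁ * (w.2.2 - t0)) ^ 2) _ z :=
    hx.sub (hρ.pow 2)
  have hp := HasDerivAt.comp_hasFDerivAt z
    (hasDerivAt_psq (‖z.1 - x0‖ ^ 2 - (r + C₁ * (z.2.2 - t0)) ^ 2)) hg
  have hq := HasDerivAt.comp_hasFDerivAt z (hasDerivAt_psq (z.2.2 - t1)) (ht.sub_const t1)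
  have hall : HasFDerivAt (barr A c L N r C₁ x0 t0 t1) _ z :=
    ((((ht.sub_const t0).const_mul c).const_add A).add (hp.const_mul L)).add (hq.const_mul N)
  refine pd_of_hasFDerivAt hall _ _ _ ?_
  intro w
  have e : inner ℝ ((4 * L * m) • (z.1 - x0)) w.1 = 4 * L * m * inner ℝ (z.1 - x0) w.1 := by
    rw [inner_smul_left]; rfl
  rw [e]
  simp only [ContinuousLinearMap.add_apply, ContinuousLinearMap.sub_apply,
    ContinuousLinearMap.smul_apply, ContinuousLinearMap.comp_apply, ContinuousLinearMap.coe_fst',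
    ContinuousLinearMap.coe_snd', innerSL_apply_apply, smul_eq_mul, nsmul_eq_mul]
  change _ = 4 * L * max (‖z.1 - x0‖ ^ 2 - (r + C₁ * (z.2.2 - t0)) ^ 2) 0 * _ + _ +
    (c - 4 * L * max (‖z.1 - x0‖ ^ 2 - (r + C₁ * (z.2.2 - t0)) ^ 2) 0 * C₁ *
      (r + C₁ * (z.2.2 - t0)) + _) * _
  push_cast
  ring

/-- Strict supersolution property of the barrier (only uses the eikonal lower bound). -/
lemma barr_op {n : ℕ} {A c L N r C₁ : ℝ} {x0 : Euc n} {t0 t1 : ℝ} (hL : 0 ≤ L) (hN : 0 ≤ N)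
    (hr : 0 < r) (hC₁ : 0 < C₁) (z : Dom n) (hz : t0 ≤ z.2.2) :
    c ≤ pdT (barr A c L N r C₁ x0 t0 t1) z + C₁ * ‖pdX (barr A c L N r C₁ x0 t0 t1) z‖ := by
  obtain ⟨e1, -, e3⟩ := barr_pd A c L N r C₁ x0 t0 t1 z
  rw [e1, e3]
  set ρ := r + C₁ * (z.2.2 - t0) with hρ
  set m := max (‖z.1 - x0‖ ^ 2 - ρ ^ 2) 0 with hm
  have hm0 : 0 ≤ m := le_max_right _ _
  have hρ0 : 0 < ρ := by
    have : 0 ≤ C₁ * (z.2.2 - t0) := mul_nonneg hC₁.le (by linarith)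
    linarith
  have hLm : 0 ≤ 4 * L * m := by positivity
  rw [norm_smul, Real.norm_eq_abs, abs_of_nonneg hLm]
  have h1 : 0 ≤ 2 * N * max (z.2.2 - t1) 0 :=
    mul_nonneg (by linarith) (le_max_right _ _)
  have h2 : 4 * L * m * C₁ * ρ ≤ C₁ * (4 * L * m * ‖z.1 - x0‖) := by
    rcases le_total (‖z.1 - x0‖ ^ 2 - ρ ^ 2) 0 with h | h
    · have : m = 0 := max_eq_right h
      rw [this]; simp
    · have h3 : ρ ≤ ‖z.1 - x0‖ := by
        refine abs_le_of_sq_le_sq' (by linarith) (norm_nonneg _) |>.2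
      have h4 : (4 * L * m * C₁) * ρ ≤ (4 * L * m * C₁) * ‖z.1 - x0‖ :=
        mul_le_mul_of_nonneg_left h3 (by positivity)
      linarith
  linarith

lemma barrier_bound {n : ℕ} {G : Ham n} {C₁ C₂ M₀ α : ℝ}
    (h2 : HypH2 G C₁ C₂) {w : Dom n → ℝ} (hwc : Continuous w) (hw : ViscSub G α 0 w)
    (hb : Bdd w) (hαw : ∀ z, |α * w z| ≤ M₀) (hper : STPeriodic w) {A t0 t1 : ℝ} {x0 : Euc n}
    (ht : t0 ≤ t1) (hA : ∀ y, w (x0, y, t0) < A) (x : Euc n) (y : ℝ)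
    (hx : ‖x - x0‖ ≤ C₁ * (t1 - t0)) :
    w (x, y, t1) ≤ A + (C₂ + M₀ + 1) * (t1 - t0) := by
  obtain ⟨hC₁, hC₂, hcoer⟩ := h2
  obtain ⟨M, hM⟩ := hb
  have hM0 : 0 ≤ M₀ := (abs_nonneg _).trans (hαw 0)
  have hperY : ∀ (j : ℤ) x y t, w (x, y + j, t) = w (x, y, t) := fun j x y t => by
    have hp : Function.Periodic (fun y => w (x, y, t)) 1 := fun y => hper.2.1 x y t
    simpa using hp.int_mul j y
  -- choice of the radius
  obtain ⟨r, hr, hrA⟩ : ∃ r > 0, ∀ x' : Euc n, ‖x' - x0‖ ≤ 2 * r → ∀ y', w (x', y', t0) < A := by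
    have hcomp : IsCompact (Set.Icc (0:ℝ) 1) := isCompact_Icc
    have hev := hcomp.eventually_forall_of_forall_eventually (x₀ := x0)
      (P := fun x' y' => w (x', y', t0) < A) (fun y' _ => by
        have hc : Continuous (fun p : Euc n × ℝ => w (p.1, p.2, t0)) := by fun_prop
        exact hc.continuousAt.eventually_lt_const (hA y'))
    obtain ⟨R, hR, hball⟩ := Metric.nhds_basis_closedBall.mem_iff.1 hev
    refine ⟨R / 2, by positivity, fun x' hx' y' => ?_⟩
    obtain ⟨j, hj1, hj2⟩ := fract_eq_add y'
    rw [← hperY j]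
    refine hball (?_ : x' ∈ Metric.closedBall x0 R) (y' + j) ⟨hj1, hj2⟩
    rw [Metric.mem_closedBall, dist_eq_norm]; linarith
  set N := |M| + |A| with hN
  have hN0 : 0 ≤ N := by positivity
  have hNM : M ≤ A + N := by
    have := le_abs_self M; have := neg_abs_le A; linarith
  set L := N / r ^ 4 with hL
  have hL0 : 0 ≤ L := by positivity
  have hLr : L * r ^ 4 = N := by rw [hL]; field_simp
  set c := C₂ + M₀ + 1 with hc
  have hc0 : 0 < c := by positivity
  set φ := barr A c L N r C₁ x0 t0 t1 with hφ
  have hφe : ∀ x y t, φ (x, y, t) = A + c * (t - t0) +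
    L * psq (‖x - x0‖ ^ 2 - (r + C₁ * (t - t0)) ^ 2) + N * psq (t - t1) := fun _ _ _ => rfl
  have hφC : ContDiff ℝ 1 φ := barr_contDiff _ _ _ _ _ _ _ _ _
  have hpsqr : ∀ s, r ^ 2 ≤ s → N ≤ L * psq s := by
    intro s hs
    have h1 : r ^ 4 ≤ psq s := by
      unfold psq
      have : r ^ 2 ≤ max s 0 := hs.trans (le_max_left _ _)
      calc r ^ 4 = (r ^ 2) ^ 2 := by ring
        _ ≤ (max s 0) ^ 2 := pow_le_pow_left₀ (by positivity) this 2
    calc N = L * r ^ 4 := hLr.symm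
      _ ≤ L * psq s := mul_le_mul_of_nonneg_left h1 hL0
  have hwM : ∀ z, w z ≤ A + N := fun z => ((abs_le.1 (hM z)).2).trans hNM
  -- boundary estimates
  have hb1 : ∀ x' y', w (x', y', t0) ≤ φ (x', y', t0) := by
    intro x' y'
    rw [hφe]
    have p1 : 0 ≤ N * psq (t0 - t1) := mul_nonneg hN0 (psq_nonneg _)
    rcases le_total ‖x' - x0‖ (2 * r) with h | h
    · have := hrA x' h y'
      have p2 : 0 ≤ L * psq (‖x' - x0‖ ^ 2 - (r + C₁ * (t0 - t0)) ^ 2) :=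
        mul_nonneg hL0 (psq_nonneg _)
      linarith [(by ring : c * (t0 - t0) = 0)]
    · have p2 := hpsqr (‖x' - x0‖ ^ 2 - (r + C₁ * (t0 - t0)) ^ 2) (by
        have : (2 * r) ^ 2 ≤ ‖x' - x0‖ ^ 2 := pow_le_pow_left₀ (by positivity) h 2
        have e : (r + C₁ * (t0 - t0)) ^ 2 = r ^ 2 := by ring
        rw [e]; nlinarith only [this, sq_nonneg r])
      have := hwM (x', y', t0)
      linarith [(by ring : c * (t0 - t0) = 0)]
  set R := 2 * r + C₁ * (t1 + 1 - t0) with hR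
  have hb2 : ∀ x' y' t', t0 ≤ t' → t' ≤ t1 + 1 → R ≤ ‖x' - x0‖ → w (x', y', t') ≤ φ (x', y', t') := by
    intro x' y' t' ha hb hx'
    rw [hφe]
    have p1 : 0 ≤ N * psq (t' - t1) := mul_nonneg hN0 (psq_nonneg _)
    have p3 : 0 ≤ c * (t' - t0) := mul_nonneg hc0.le (by linarith)
    have p2 := hpsqr (‖x' - x0‖ ^ 2 - (r + C₁ * (t' - t0)) ^ 2) (by
      have q1 : 0 ≤ C₁ * (t' - t0) := mul_nonneg hC₁.le (by linarith)
      have q2 : C₁ * (t' - t0) ≤ C₁ * (t1 + 1 - t0) := mul_le_mul_of_nonneg_left (by linarith) hC₁.le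
      have q3 : (r + (r + C₁ * (t' - t0))) ^ 2 ≤ ‖x' - x0‖ ^ 2 :=
        pow_le_pow_left₀ (by positivity) (by linarith) 2
      nlinarith only [q1, q3, hr])
    have := hwM (x', y', t')
    linarith
  have hb3 : ∀ x' y', w (x', y', t1 + 1) ≤ φ (x', y', t1 + 1) := by
    intro x' y'
    rw [hφe]
    have p2 : 0 ≤ L * psq (‖x' - x0‖ ^ 2 - (r + C₁ * (t1 + 1 - t0)) ^ 2) :=
        mul_nonneg hL0 (psq_nonneg _)
    have p3 : 0 ≤ c * (t1 + 1 - t0) := mul_nonneg hc0.le (by linarith)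
    have p1 : psq (t1 + 1 - t1) = 1 := by simp [psq]
    have := hwM (x', y', t1 + 1)
    rw [p1]
    linarith
  have hφ1 : φ (x, y, t1) = A + c * (t1 - t0) := by
    rw [hφe, sub_self t1, psq_eq_zero le_rfl, psq_eq_zero]
    · ring
    · have : ‖x - x0‖ ^ 2 ≤ (r + C₁ * (t1 - t0)) ^ 2 :=
        pow_le_pow_left₀ (norm_nonneg _) (by linarith) 2
      linarith
  by_contra hcon
  push Not at hcon
  -- the maximum point
  set K : Set (Dom n) := Metric.closedBall x0 R ×ˢ Set.Icc (0:ℝ) 1 ×ˢ Set.Icc t0 (t1 + 1) with hK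
  have hKc : IsCompact K := (isCompact_closedBall _ _).prod (isCompact_Icc.prod isCompact_Icc)
  obtain ⟨jy, hj1, hj2⟩ := fract_eq_add y
  have hmem : ((x, y + jy, t1) : Dom n) ∈ K := by
    refine ⟨?_, ⟨hj1, hj2⟩, ht, by simp⟩
    rw [Metric.mem_closedBall, dist_eq_norm]
    simp only
    have : C₁ * (t1 + 1 - t0) = C₁ * (t1 - t0) + C₁ := by ring
    linarith
  obtain ⟨⟨xm, ym, tm⟩, hm, hmax⟩ := hKc.exists_isMaxOn (f := fun z => w z - φ z) ⟨_, hmem⟩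
    (hwc.sub hφC.continuous).continuousOn
  have hpos : 0 < w (xm, ym, tm) - φ (xm, ym, tm) := by
    have : w (x, y + jy, t1) - φ (x, y + jy, t1) ≤ w (xm, ym, tm) - φ (xm, ym, tm) := hmax hmem
    rw [hperY] at this
    have e : φ (x, y + jy, t1) = φ (x, y, t1) := rfl
    rw [e, hφ1] at this
    linarith
  obtain ⟨hm1, -, hm2, hm3⟩ := hm
  simp only at hm1 hm2 hm3
  have hx1 : xm ∈ Metric.ball x0 R := by
    rw [Metric.mem_ball, dist_eq_norm]
    by_contra h
    push Not at h
    have := hb2 xm ym tm hm2 hm3 h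
    linarith
  have ht1 : t0 < tm := by
    refine lt_of_le_of_ne hm2 fun h => ?_
    have := hb1 xm ym
    rw [h] at this
    linarith
  have ht2 : tm < t1 + 1 := by
    refine lt_of_le_of_ne hm3 fun h => ?_
    have := hb3 xm ym
    rw [← h] at this
    linarith
  have hloc : IsLocalMax (fun z => w z - φ z) (xm, ym, tm) := by
    have hnb : Metric.ball x0 R ×ˢ (Set.univ : Set ℝ) ×ˢ Set.Ioo t0 (t1 + 1) ∈
        𝓝 ((xm, ym, tm) : Dom n) := by
      refine (Metric.isOpen_ball.prod (isOpen_univ.prod isOpen_Ioo)).mem_nhds ?_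
      exact ⟨hx1, Set.mem_univ _, ht1, ht2⟩
    filter_upwards [hnb] with z' hz'
    obtain ⟨x', y', t'⟩ := z'
    obtain ⟨g1, -, g2⟩ := hz'
    obtain ⟨j, hj1, hj2⟩ := fract_eq_add y'
    have : w (x', y' + j, t') - φ (x', y' + j, t') ≤ w (xm, ym, tm) - φ (xm, ym, tm) :=
      hmax (a := (x', y' + j, t'))
      ⟨Metric.ball_subset_closedBall g1, ⟨hj1, hj2⟩, Set.Ioo_subset_Icc_self g2⟩
    rw [hperY] at this
    exact this
  have hv := hw.2 φ hφC _ hloc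
  have hop := barr_op (A := A) (c := c) (x0 := x0) (t0 := t0) (t1 := t1) hL0 hN0 hr hC₁
    (xm, ym, tm) hm2
  rw [(barr_pd A c L N r C₁ x0 t0 t1 (xm, ym, tm)).2.1] at hv
  have hco := hcoer xm ym tm (pdX φ (xm, ym, tm))
  have := (abs_le.1 (hαw (xm, ym, tm))).1
  simp only at hv
  linarith

theorem osc_bound {n : ℕ} {G : Ham n} {C₁ C₂ M₀ α l : ℝ}
    (h2 : HypH2 G C₁ C₂) {w : Dom n → ℝ} (hwc : Continuous w) (hw : ViscSub G α 0 w)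
    (hb : Bdd w) (hαw : ∀ z, |α * w z| ≤ M₀) (hper : STPeriodic w)
    (hosc : ∀ x y y' t, w (x, y, t) ≤ w (x, y', t) + |l|) (z z0 : Dom n) :
    w z ≤ w z0 + (|l| + 1 + (C₂ + M₀ + 1) * (√n / C₁ + 1)) := by
  obtain ⟨x, y, t⟩ := z
  obtain ⟨x0, y0, t0⟩ := z0
  have hC₁ := h2.1
  have hM0 : 0 ≤ M₀ := (abs_nonneg _).trans (hαw 0)
  obtain ⟨j, hj1, hj2⟩ := fract_eq_add (t - t0 - √n / C₁)
  obtain ⟨k, hk⟩ := exists_intVec (x - x0)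
  have hperT : ∀ (j : ℤ) x y t, w (x, y, t + j) = w (x, y, t) := fun j x y t => by
    have hp : Function.Periodic (fun t => w (x, y, t)) 1 := fun t => hper.2.2 x y t
    simpa using hp.int_mul j t
  have hT : 0 ≤ √n / C₁ := by positivity
  have h := barrier_bound h2 hwc hw hb hαw hper (A := w (x0, y0, t0) + |l| + 1) (t0 := t0)
    (t1 := t + j) (x0 := x0) (by linarith) (fun y' => by
      have := hosc x0 y' y0 t0; linarith) (x + intVec k) y (by
      have e : x + intVec k - x0 = x - x0 + intVec k := by abel
      rw [e]
      refine hk.trans ?_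
      rw [div_eq_mul_inv] at hj1
      calc √(n:ℝ) = C₁ * (√n * C₁⁻¹) := by field_simp
        _ ≤ C₁ * (t + j - t0) := mul_le_mul_of_nonneg_left (by linarith) hC₁.le)
  rw [hperT, hper.1] at h
  have h5 : (C₂ + M₀ + 1) * (t + j - t0) ≤ (C₂ + M₀ + 1) * (√n / C₁ + 1) :=
    mul_le_mul_of_nonneg_left (by linarith) (by have := h2.2.1; linarith)
  linarith

lemma approx_sol {n : ℕ} {G : Ham n} {C₁ C₂ l C₃ C₄ C₅ M₀ : ℝ} (h1 : HypH1 G)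
    (h2 : HypH2 G C₁ C₂) (h3 : HypH3 G l C₃ C₄ C₅)
    (hM : ∀ (x : Euc n) (y t : ℝ), |G x y t 0 0| ≤ M₀) :
    ∃ K, ∀ α : ℝ, 0 < α → ∃ lam ∈ Set.Icc (-M₀) M₀, ∃ u : Dom n → ℝ, (∀ z, |u z| ≤ K) ∧
      ViscSub G 0 (lam + α * K) u ∧ ViscSuper G 0 (lam - α * K) u := by
  refine ⟨|l| + 1 + (C₂ + M₀ + 1) * (√n / C₁ + 1), fun α hα => ?_⟩
  set K := |l| + 1 + (C₂ + M₀ + 1) * (√n / C₁ + 1) with hK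
  obtain ⟨w, hwc, hsub, hsup, hαw, hper, hosc⟩ := perron h1 h2 h3 hα hM
  have hb : Bdd w := by
    refine ⟨M₀ / α, fun z => ?_⟩
    have := hαw z
    rw [abs_mul, abs_of_pos hα] at this
    rw [le_div_iff₀ hα]; linarith
  have hos := osc_bound h2 hwc hsub hb hαw hper hosc
  have hup : ∀ z, w z - w 0 ≤ K := fun z => by have := hos z 0; linarith
  have hlo : ∀ z, -K ≤ w z - w 0 := fun z => by have := hos 0 z; linarith
  refine ⟨-(α * w 0), ?_, fun z => w z - w 0, fun z => abs_le.2 ⟨hlo z, hup z⟩, ⟨?_, ?_⟩, ⟨?_, ?_⟩⟩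
  · have := abs_le.1 (hαw 0)
    exact ⟨by linarith, by linarith⟩
  · exact (hwc.sub continuous_const).upperSemicontinuous
  · intro φ hφ z hz
    have := hsub.2 φ hφ z (by
      filter_upwards [hz] with z' hz'
      linarith)
    have h5 : α * (-K) ≤ α * (w z - w 0) := mul_le_mul_of_nonneg_left (hlo z) hα.le
    linarith
  · exact (hwc.sub continuous_const).lowerSemicontinuous
  · intro φ hφ z hz
    have := hsup.2 φ hφ z (by
      filter_upwards [hz] with z' hz'
      linarith)
    have h5 : α * (w z - w 0) ≤ α * K := mul_le_mul_of_nonneg_left (hup z) hα.le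
    linarith

theorem ergodic_exists {n : ℕ} {G : Ham n} {C₁ C₂ l C₃ C₄ C₅ : ℝ} (h1 : HypH1 G)
    (h2 : HypH2 G C₁ C₂) (h3 : HypH3 G l C₃ C₄ C₅) : ∃ lam, ErgodicConst G lam := by
  obtain ⟨M₀, -, hM⟩ := bddG0 h1
  obtain ⟨K, hK⟩ := approx_sol h1 h2 h3 hM
  have hα : ∀ k : ℕ, (0:ℝ) < 1 / ((k:ℝ) + 1) := fun k => by positivity
  choose lamk hlam u hub hsub hsup using fun k : ℕ => hK (1 / ((k:ℝ) + 1)) (hα k)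
  obtain ⟨lam, -, s, hs, hlim⟩ := isCompact_Icc.tendsto_subseq hlam
  have hαlim : Tendsto (fun k : ℕ => 1 / (((s k : ℕ) : ℝ) + 1) * K) atTop (𝓝 0) := by
    have := (tendsto_one_div_add_atTop_nhds_zero_nat (𝕜 := ℝ)).comp hs.tendsto_atTop
    simpa using this.mul_const K
  refine ⟨lam, ?_, ?_⟩
  · obtain ⟨U, hU, hUb⟩ := exists_relSup atTop (fun k => u (s k)) K (fun k z => hub _ z)
    refine ⟨U, ⟨K, hUb⟩, stability h1.1 hU le_rfl
      (L := fun k => lamk (s k) + 1 / (((s k : ℕ) : ℝ) + 1) * K) ?_ (fun k => hsub (s k))⟩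
    simpa using hlim.add hαlim
  · obtain ⟨V, hV, hVb⟩ := exists_relSup atTop (fun k z => - u (s k) z) K
      (fun k z => by rw [abs_neg]; exact hub _ z)
    refine ⟨fun z => - V z, ⟨K, fun z => by rw [abs_neg]; exact hVb z⟩, sub_to_super ?_⟩
    refine stability (dualH_cont h1.1) hV le_rfl
      (L := fun k => -(lamk (s k) - 1 / (((s k : ℕ) : ℝ) + 1) * K)) ?_
      (fun k => super_to_sub (hsup (s k)))
    simpa using (hlim.sub hαlim).neg

/-- Under (H1)–(H3), there exists a unique constant λ̄ such that
`w_t + G(x,y,t,D_x w,D_y w) = λ̄` on ℝⁿ×ℝ×ℝ admits both a bounded usc viscosity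
subsolution and a bounded lsc viscosity supersolution. -/
theorem statement2 {n : ℕ} (hn : 0 < n) (G : Ham n) (C₁ C₂ l C₃ C₄ C₅ : ℝ)
    (h1 : HypH1 G) (h2 : HypH2 G C₁ C₂) (h3 : HypH3 G l C₃ C₄ C₅) :
    ∃! lam : ℝ, ErgodicConst G lam := by
  obtain ⟨lam, hlam⟩ := ergodic_exists h1 h2 h3
  exact ⟨lam, hlam, fun lam2 h => le_antisymm (ergodic_le h1 h2 h3 h hlam)
    (ergodic_le h1 h2 h3 hlam h)⟩
end
end

section
/- Assume (H1)–(H3) with l = 0 in (H3), let α > 0 and let w^α be a continuous space-time periodic viscosity solution of w^α_t + G(x,y,t,D_x w^α, D_y w^α) + α w^α = 0 on ℝⁿ×ℝ×ℝ. Then w^α is independent of y, i.e. w^α(x,y,t) = w^α(x,y',t) for all x ∈ ℝⁿ, y, y', t ∈ ℝ. -/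
open MeasureTheory Topology Filter
open scoped RealInnerProductSpace

noncomputable section

/-- A locally Lipschitz function of one variable with a.e. bounded derivative. -/
lemma lip_of_ae {g : ℝ → ℝ} (hg : LocallyLipschitz g) {s t C : ℝ}
    (h : ∀ᵐ x, x ∈ Set.uIoc s t → |deriv g x| ≤ C) : |g t - g s| ≤ C * |t - s| := by
  obtain ⟨K, hK⟩ := (hg.locallyLipschitzOn (s := Set.uIcc s t)).exists_lipschitzOnWith_of_compact
    isCompact_uIcc
  rw [← hK.absolutelyContinuousOnInterval.integral_deriv_eq_sub]
  exact intervalIntegral.norm_integral_le_of_norm_le_const_ae (f := deriv g) h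

/-- A Gronwall type estimate for short times. -/
lemma gronwall_short {g : ℝ → ℝ} (hg : LocallyLipschitz g) {s t C B : ℝ} (hC : 0 ≤ C)
    (h : ∀ᵐ x, |deriv g x| ≤ C * (B + |g x|)) (hst : C * |t - s| ≤ 1 / 2) :
    |g t - g s| ≤ 2 * C * |t - s| * (B + |g s|) := by
  obtain ⟨τ, hτ, hmax⟩ := (isCompact_uIcc (a := s) (b := t)).exists_isMaxOn
    Set.nonempty_uIcc (f := fun x => |g x|) hg.continuous.abs.continuousOn
  have key : ∀ r ∈ Set.uIcc s t, |g r - g s| ≤ C * (B + |g τ|) * |r - s| := by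
    intro r hr
    apply lip_of_ae hg
    filter_upwards [h] with x hx hxm
    have hx2 : x ∈ Set.uIcc s t :=
      (Set.uIcc_subset_uIcc_left hr) (Set.uIoc_subset_uIcc hxm)
    have := hmax hx2
    simp only [Set.mem_ofPred_eq] at this
    refine hx.trans ?_
    gcongr
  have h1 := key τ hτ
  have h2 := key t Set.right_mem_uIcc
  have h3 : |τ - s| ≤ |t - s| := Set.abs_sub_left_of_mem_uIcc hτ
  have h4 : |g τ| ≤ |g s| + |g τ - g s| := by
    have := abs_add_le (g s) (g τ - g s); simpa using this
  by_cases hB : 0 ≤ B + |g τ|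
  · have h5 : C * (B + |g τ|) * |τ - s| ≤ (B + |g τ|) / 2 := by
      calc C * (B + |g τ|) * |τ - s| ≤ C * (B + |g τ|) * |t - s| := by gcongr
        _ = (C * |t - s|) * (B + |g τ|) := by ring
        _ ≤ (1/2) * (B + |g τ|) := by gcongr
        _ = _ := by ring
    have h6 : B + |g τ| ≤ 2 * (B + |g s|) := by linarith
    calc |g t - g s| ≤ C * (B + |g τ|) * |t - s| := h2
      _ ≤ C * (2 * (B + |g s|)) * |t - s| := by gcongr
      _ = _ := by ring
  · push Not at hB
    have h7 : |g s| ≤ |g τ| := hmax Set.left_mem_uIcc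
    have h8 : |g τ - g s| = 0 := by
      apply le_antisymm _ (abs_nonneg _)
      refine h1.trans ?_
      have : C * (B + |g τ|) ≤ 0 := mul_nonpos_of_nonneg_of_nonpos hC hB.le
      exact mul_nonpos_of_nonpos_of_nonneg this (abs_nonneg _)
    have h9 : |g τ| = |g s| := by linarith
    rw [h9] at h2
    have : 0 ≤ C * (B + |g s|) * |t - s| := (abs_nonneg _).trans h2
    linarith

lemma forall_of_ae_closed {X : Type*} [TopologicalSpace X] [MeasurableSpace X] {μ : Measure X}
    [μ.IsOpenPosMeasure] {p : X → Prop} (hc : IsClosed {x | p x}) (h : ∀ᵐ x ∂μ, p x) :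
    ∀ x, p x := by
  have := (Measure.dense_of_ae h).closure_eq
  rw [hc.closure_eq] at this
  intro x
  have : x ∈ {x | p x} := by rw [this]; trivial
  exact this

lemma ae_swap {X Y : Type*} [MeasureSpace X] [MeasureSpace Y]
    [SFinite (volume : Measure X)] [SFinite (volume : Measure Y)] {p : X × Y → Prop}
    (h : ∀ᵐ z, p z) : ∀ᵐ y : Y, ∀ᵐ x : X, p (x, y) := by
  have := (Measure.measurePreserving_swap (μ := (volume : Measure Y))
    (ν := (volume : Measure X))).quasiMeasurePreserving.ae h
  exact Measure.ae_ae_of_ae_prod this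

/-- `G(x,y,t,p,0)` is independent of `y`. -/
lemma G_indep_y {n : ℕ} {G : Ham n} {C₃ C₄ C₅ : ℝ} (h1 : HypH1 G) (h3 : HypH3 G 0 C₃ C₄ C₅)
    (x : Euc n) (y y' t : ℝ) (p : Euc n) : G x y t p 0 = G x y' t p 0 := by
  obtain ⟨hc, -⟩ := h1
  obtain ⟨-, -, -, hL, hae⟩ := h3
  have hcont : ∀ y, Continuous (fun q : Euc n × ℝ × Euc n × ℝ => G q.1 y q.2.1 q.2.2.1 q.2.2.2) := by
    intro y
    exact hc.comp (f := fun q : Euc n × ℝ × Euc n × ℝ => ((q.1, y, q.2.1, q.2.2.1, q.2.2.2) : Xi n))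
      (by fun_prop)
  have main : ∀ᵐ x : Euc n, ∀ᵐ r : ℝ × Euc n × ℝ,
      |G x y r.1 r.2.1 r.2.2 - G x y' r.1 r.2.1 r.2.2| ≤ C₃ * |r.2.2 + 0| * |y - y'| := by
    filter_upwards [Measure.ae_ae_of_ae_prod hae] with x hx
    filter_upwards [ae_swap hx] with r hr
    apply lip_of_ae (g := fun y => G x y r.1 r.2.1 r.2.2)
    · exact (hL x r.2.1).comp (LipschitzWith.prodMk_right (r.1, r.2.2)).locallyLipschitz
    · filter_upwards [hr] with z hz _ using hz.1
  have A : ∀ x : Euc n, ∀ r : ℝ × Euc n × ℝ,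
      |G x y r.1 r.2.1 r.2.2 - G x y' r.1 r.2.1 r.2.2| ≤ C₃ * |r.2.2 + 0| * |y - y'| := by
    have B : ∀ᵐ x : Euc n, ∀ r : ℝ × Euc n × ℝ,
        |G x y r.1 r.2.1 r.2.2 - G x y' r.1 r.2.1 r.2.2| ≤ C₃ * |r.2.2 + 0| * |y - y'| := by
      filter_upwards [main] with x hx
      refine forall_of_ae_closed ?_ hx
      apply isClosed_le _ (by fun_prop)
      exact (((hcont y).comp (Continuous.prodMk_right x)).sub
        ((hcont y').comp (Continuous.prodMk_right x))).abs
    refine forall_of_ae_closed ?_ B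
    simp only [Set.ofPred_forall]
    refine isClosed_iInter fun r => ?_
    apply isClosed_le _ (by fun_prop)
    exact (((hcont y).comp (Continuous.prodMk_left r)).sub
        ((hcont y').comp (Continuous.prodMk_left r))).abs
  have := A x (t, p, 0)
  simp only [add_zero, abs_zero, mul_zero, zero_mul] at this
  have := abs_nonpos_iff.1 this
  linarith

/-- Time regularity of `G(x,y,t,p,0)`. -/
lemma G_time {n : ℕ} {G : Ham n} {C₃ C₄ C₅ : ℝ} (h1 : HypH1 G) (h3 : HypH3 G 0 C₃ C₄ C₅)
    (x : Euc n) (y s t : ℝ) (p : Euc n) (hst : C₄ * |t - s| ≤ 1 / 2) :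
    |G x y t p 0 - G x y s p 0| ≤ 2 * C₄ * |t - s| * (1 + |G x y s p 0|) := by
  obtain ⟨hc, -⟩ := h1
  obtain ⟨-, hC4, -, hL, hae⟩ := h3
  have hcont : ∀ t, Continuous (fun q : Euc n × ℝ × Euc n × ℝ => G q.1 q.2.1 t q.2.2.1 q.2.2.2) := by
    intro t
    exact hc.comp (f := fun q : Euc n × ℝ × Euc n × ℝ => ((q.1, q.2.1, t, q.2.2.1, q.2.2.2) : Xi n))
      (by fun_prop)
  have main : ∀ᵐ x : Euc n, ∀ᵐ y : ℝ, ∀ᵐ r : Euc n × ℝ,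
      |G x y t r.1 r.2 - G x y s r.1 r.2| ≤ 2 * C₄ * |t - s| * (1 + |r.2| + |G x y s r.1 r.2|) := by
    filter_upwards [Measure.ae_ae_of_ae_prod hae] with x hx
    filter_upwards [Measure.ae_ae_of_ae_prod hx] with y hy
    filter_upwards [ae_swap hy] with r hr
    apply gronwall_short (g := fun t => G x y t r.1 r.2) _ hC4 _ hst
    · have : LipschitzWith 1 (fun t : ℝ => (y, t, r.2)) := by
        have := (LipschitzWith.prodMk_left (β := ℝ × ℝ) y).comp (LipschitzWith.prodMk_right (α := ℝ) r.2)
        rw [one_mul] at this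
        exact this
      exact (hL x r.1).comp this.locallyLipschitz
    · filter_upwards [hr] with z hz using hz.2.1
  have cl : ∀ {X : Type} [TopologicalSpace X] (f : X → Euc n × ℝ × Euc n × ℝ), Continuous f →
      IsClosed {a | |G (f a).1 (f a).2.1 t (f a).2.2.1 (f a).2.2.2
        - G (f a).1 (f a).2.1 s (f a).2.2.1 (f a).2.2.2| ≤
        2 * C₄ * |t - s| * (1 + |(f a).2.2.2| + |G (f a).1 (f a).2.1 s (f a).2.2.1 (f a).2.2.2|)} := by
    intro X _ f hf
    have e1 := (hcont t).comp hf
    have e2 := (hcont s).comp hf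
    apply isClosed_le
    · exact (e1.sub e2).abs
    · exact continuous_const.mul ((by fun_prop : Continuous fun a => 1 + |(f a).2.2.2|).add e2.abs)
  have A1 : ∀ᵐ x : Euc n, ∀ᵐ y : ℝ, ∀ r : Euc n × ℝ,
      |G x y t r.1 r.2 - G x y s r.1 r.2| ≤ 2 * C₄ * |t - s| * (1 + |r.2| + |G x y s r.1 r.2|) := by
    filter_upwards [main] with x hx
    filter_upwards [hx] with y hy
    exact forall_of_ae_closed (cl (fun r : Euc n × ℝ => (x, y, r)) (by fun_prop)) hy
  have A2 : ∀ᵐ x : Euc n, ∀ y : ℝ, ∀ r : Euc n × ℝ,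
      |G x y t r.1 r.2 - G x y s r.1 r.2| ≤ 2 * C₄ * |t - s| * (1 + |r.2| + |G x y s r.1 r.2|) := by
    filter_upwards [A1] with x hx
    refine forall_of_ae_closed ?_ hx
    simp only [Set.ofPred_forall]
    exact isClosed_iInter fun r => cl (fun y : ℝ => (x, y, r)) (by fun_prop)
  have A3 : ∀ x : Euc n, ∀ y : ℝ, ∀ r : Euc n × ℝ,
      |G x y t r.1 r.2 - G x y s r.1 r.2| ≤ 2 * C₄ * |t - s| * (1 + |r.2| + |G x y s r.1 r.2|) := by
    refine forall_of_ae_closed ?_ A2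
    simp only [Set.ofPred_forall]
    exact isClosed_iInter fun y => isClosed_iInter fun r => cl (fun x => (x, y, r)) (by fun_prop)
  simpa using A3 x y (p, 0)

/-- The quadratic test function. -/
def qtest {n : ℕ} (c d : ℝ) (x₀ : Euc n) (t₀ : ℝ) (z : Dom n) : ℝ :=
  c * ‖z.1 - x₀‖ ^ 2 + d * (z.2.2 - t₀) ^ 2

lemma qtest_contDiff {n : ℕ} (c d : ℝ) (x₀ : Euc n) (t₀ : ℝ) : ContDiff ℝ 1 (qtest c d x₀ t₀) := by
  unfold qtest
  have : ContDiff ℝ 1 (fun z : Dom n => ‖z.1 - x₀‖ ^ 2) :=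
    ContDiff.norm_sq ℝ (by fun_prop)
  fun_prop

lemma qtest_fderiv {n : ℕ} (c d : ℝ) (x₀ : Euc n) (t₀ : ℝ) (z v : Dom n) :
    fderiv ℝ (qtest c d x₀ t₀) z v = 2 * c * inner ℝ (z.1 - x₀) v.1 + 2 * d * (z.2.2 - t₀) * v.2.2 := by
  have h1 : HasFDerivAt (fun z : Dom n => z.1 - x₀) (ContinuousLinearMap.fst ℝ (Euc n) (ℝ × ℝ)) z :=
    hasFDerivAt_fst.sub_const x₀
  have h2 : HasFDerivAt (fun z : Dom n => z.2.2 - t₀)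
      ((ContinuousLinearMap.snd ℝ ℝ ℝ).comp (ContinuousLinearMap.snd ℝ (Euc n) (ℝ × ℝ))) z :=
    ((ContinuousLinearMap.snd ℝ ℝ ℝ).comp
      (ContinuousLinearMap.snd ℝ (Euc n) (ℝ × ℝ))).hasFDerivAt.sub_const t₀
  have h3 := (h1.norm_sq.const_mul c).add ((h2.pow 2).const_mul d)
  have h4 : HasFDerivAt (qtest c d x₀ t₀) _ z := h3
  rw [h4.fderiv]
  simp [inner_sub_left]
  ring

lemma qtest_pdT {n : ℕ} (c d : ℝ) (x₀ : Euc n) (t₀ : ℝ) (z : Dom n) :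
    pdT (qtest c d x₀ t₀) z = 2 * d * (z.2.2 - t₀) := by
  simp [pdT, qtest_fderiv]

lemma qtest_pdY {n : ℕ} (c d : ℝ) (x₀ : Euc n) (t₀ : ℝ) (z : Dom n) :
    pdY (qtest c d x₀ t₀) z = 0 := by
  simp [pdY, qtest_fderiv]

lemma qtest_pdX {n : ℕ} (c d : ℝ) (x₀ : Euc n) (t₀ : ℝ) (z : Dom n) :
    pdX (qtest c d x₀ t₀) z = (2 * c) • (z.1 - x₀) := by
  ext i
  simp [pdX, qtest_fderiv, EuclideanSpace.inner_single_right]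

/-- Shift into the fundamental domain. -/
lemma exists_shift {n : ℕ} (x : Euc n) : ∃ k : Fin n → ℤ, ‖x + intVec k‖ ≤ n := by
  refine ⟨fun i => -⌊x i⌋, ?_⟩
  have h : ∀ i, ‖(x + intVec (fun i => -⌊x i⌋)) i‖ ≤ 1 := by
    intro i
    have : (x + intVec (fun i => -⌊x i⌋)) i = Int.fract (x i) := by
      simp [intVec, Int.fract, sub_eq_add_neg]
    rw [this, Real.norm_eq_abs, abs_of_nonneg (Int.fract_nonneg _)]
    exact (Int.fract_lt_one _).le
  rw [EuclideanSpace.norm_eq]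
  apply Real.sqrt_le_iff.2 ⟨by positivity, ?_⟩
  calc _ ≤ ∑ i : Fin n, (1 : ℝ) := Finset.sum_le_sum fun i _ => by
        have := h i
        nlinarith [norm_nonneg ((x + intVec (fun i => -⌊x i⌋)) i)]
    _ = n := by simp
    _ ≤ (n : ℝ) ^ 2 := by
        rcases Nat.eq_zero_or_pos n with h | h
        · simp [h]
        · have : (1 : ℝ) ≤ n := by exact_mod_cast h
          nlinarith

lemma shift_y {n : ℕ} {w : Dom n → ℝ} (hper : STPeriodic w) (x : Euc n) (y t : ℝ) :
    w (x, Int.fract y, t) = w (x, y, t) := by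
  have : Function.Periodic (fun y => w (x, y, t)) 1 := fun y => hper.2.1 x y t
  have := this.sub_int_mul_eq (x := y) ⌊y⌋
  rw [mul_one] at this
  exact this

lemma shift_t {n : ℕ} {w : Dom n → ℝ} (hper : STPeriodic w) (x : Euc n) (y t : ℝ) (k : ℤ) :
    w (x, y, t - k) = w (x, y, t) := by
  have : Function.Periodic (fun t => w (x, y, t)) 1 := fun t => hper.2.2 x y t
  have := this.sub_int_mul_eq (x := t) k
  rw [mul_one] at this
  exact this

lemma dom_mem_ball {n : ℕ} {R : ℝ} {x : Euc n} {y t : ℝ} (hx : ‖x‖ ≤ R) (hy : |y| ≤ R)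
    (ht : |t| ≤ R) : ((x, y, t) : Dom n) ∈ Metric.closedBall (0 : Dom n) R := by
  rw [mem_closedBall_zero_iff]
  simp only [Prod.norm_mk, Real.norm_eq_abs]
  exact max_le hx (max_le hy ht)

lemma abs_fract_le (y : ℝ) : |Int.fract y| ≤ 1 := by
  rw [abs_of_nonneg (Int.fract_nonneg _)]
  exact (Int.fract_lt_one _).le

lemma periodic_bdd {n : ℕ} {w : Dom n → ℝ} (hw : Continuous w) (hper : STPeriodic w) :
    ∃ M, 0 ≤ M ∧ ∀ z, |w z| ≤ M := by
  obtain ⟨M, hM⟩ := (isCompact_closedBall (0 : Dom n) (n + 1)).exists_bound_of_continuousOn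
    hw.continuousOn
  have key : ∀ z, |w z| ≤ M := by
    rintro ⟨x, y, t⟩
    obtain ⟨k, hk⟩ := exists_shift x
    have := hM (x + intVec k, Int.fract y, t - ⌊t⌋) (dom_mem_ball (by linarith)
      ((abs_fract_le y).trans (by linarith [Nat.cast_nonneg (α := ℝ) n]))
      ((abs_fract_le t).trans (by linarith [Nat.cast_nonneg (α := ℝ) n])))
    rwa [shift_t hper, shift_y hper, hper.1, Real.norm_eq_abs] at this
  exact ⟨M, (abs_nonneg _).trans (key 0), key⟩

lemma max_exists {n : ℕ} {w : Dom n → ℝ} (hw : Continuous w) (hper : STPeriodic w) {M : ℝ}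
    (hM0 : 0 ≤ M) (hM : ∀ z, |w z| ≤ M) {c d : ℝ} (hc : 1 ≤ c) (hd : 1 ≤ d) :
    ∃ z ∈ Metric.closedBall (0 : Dom n) (n + 2 * M + 2),
    ∃ z' ∈ Metric.closedBall (0 : Dom n) (n + 2 * M + 2), ∀ a a' : Dom n,
      w a - w a' - qtest c d a'.1 a'.2.2 a ≤ w z - w z' - qtest c d z'.1 z'.2.2 z := by
  set R : ℝ := n + 2 * M + 2 with hR
  have hn0 : (0 : ℝ) ≤ n := Nat.cast_nonneg n
  have hR0 : 0 ≤ R := by positivity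
  have hK := (isCompact_closedBall (0 : Dom n) R).prod (isCompact_closedBall (0 : Dom n) R)
  have h0 : ((0, 0) : Dom n × Dom n) ∈ Metric.closedBall (0 : Dom n) R ×ˢ Metric.closedBall (0 : Dom n) R :=
    ⟨Metric.mem_closedBall_self hR0, Metric.mem_closedBall_self hR0⟩
  have hcont : Continuous (fun q : Dom n × Dom n => w q.1 - w q.2 - qtest c d q.2.1 q.2.2.2 q.1) := by
    unfold qtest; fun_prop
  obtain ⟨⟨z, z'⟩, hz, hmax⟩ := hK.exists_isMaxOn ⟨_, h0⟩ hcont.continuousOn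
  refine ⟨z, hz.1, z', hz.2, ?_⟩
  rintro ⟨x, y, t⟩ ⟨x', y', t'⟩
  have hpos : 0 ≤ w z - w z' - qtest c d z'.1 z'.2.2 z := by
    have := hmax h0
    simpa [qtest] using this
  by_cases hfar : ‖x - x'‖ ≤ 2 * M + 1 ∧ |t - t'| ≤ 2 * M + 1
  · obtain ⟨k, hk⟩ := exists_shift x
    have e1 : ((x + intVec k, Int.fract y, t - ⌊t⌋) : Dom n) ∈ Metric.closedBall (0 : Dom n) R :=
      dom_mem_ball (by linarith) ((abs_fract_le y).trans (by linarith))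
        ((abs_fract_le t).trans (by linarith))
    have e2 : ((x' + intVec k, Int.fract y', t' - ⌊t⌋) : Dom n) ∈ Metric.closedBall (0 : Dom n) R := by
      refine dom_mem_ball ?_ ((abs_fract_le y').trans (by linarith)) ?_
      · have : x' + intVec k = (x + intVec k) - (x - x') := by abel
        rw [this]
        exact (norm_sub_le _ _).trans (by linarith [hfar.1])
      · have : t' - ⌊t⌋ = Int.fract t - (t - t') := by unfold Int.fract; ring
        rw [this]
        exact (abs_sub _ _).trans (by linarith [hfar.2, abs_fract_le t])
    have := hmax (Set.mk_mem_prod e1 e2)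
    simp only [Set.mem_ofPred_eq] at this
    rw [shift_t hper, shift_y hper, hper.1, shift_t hper, shift_y hper, hper.1] at this
    refine le_trans (le_of_eq ?_) this
    have e3 : t - t' = t - (⌊t⌋ : ℝ) - (t' - ⌊t⌋) := by ring
    simp only [qtest, add_sub_add_right_eq_sub]
    rw [← e3]
  · refine le_trans ?_ hpos
    have b1 := abs_le.1 (hM (x, y, t))
    have b2 := abs_le.1 (hM (x', y', t'))
    have : 2 * M ≤ qtest c d x' t' (x, y, t) := by
      unfold qtest
      simp only
      have p1 := norm_nonneg (x - x')
      have p2 := abs_nonneg (t - t')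
      rw [← sq_abs (t - t')]
      have q1 : ‖x - x'‖ ^ 2 ≤ c * ‖x - x'‖ ^ 2 := le_mul_of_one_le_left (by positivity) hc
      have q2 : |t - t'| ^ 2 ≤ d * |t - t'| ^ 2 := le_mul_of_one_le_left (by positivity) hd
      rw [not_and_or, not_le, not_le] at hfar
      rcases hfar with h | h <;> nlinarith
    simp only
    linarith

/-- The consequence of the doubling of variables at a maximum point. -/
lemma doubling {n : ℕ} {G : Ham n} {α : ℝ} {w : Dom n → ℝ} (hsol : ViscSol G α 0 w) {c d : ℝ}
    {z z' : Dom n} (hmax : ∀ a a' : Dom n,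
      w a - w a' - qtest c d a'.1 a'.2.2 a ≤ w z - w z' - qtest c d z'.1 z'.2.2 z) :
    2 * d * (z.2.2 - z'.2.2) + G z.1 z.2.1 z.2.2 ((2 * c) • (z.1 - z'.1)) 0 + α * w z ≤ 0 ∧
    0 ≤ 2 * d * (z.2.2 - z'.2.2) + G z'.1 z'.2.1 z'.2.2 ((2 * c) • (z.1 - z'.1)) 0 + α * w z' := by
  obtain ⟨-, hsub, hsup⟩ := hsol
  constructor
  · have := hsub.2 (qtest c d z'.1 z'.2.2) (qtest_contDiff _ _ _ _) z
      (Eventually.of_forall fun a => by have := hmax a z'; linarith)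
    rwa [qtest_pdT, qtest_pdX, qtest_pdY] at this
  · have hneg : ∀ a : Dom n, qtest (-c) (-d) z.1 z.2.2 a = - qtest c d a.1 a.2.2 z := by
      intro a
      unfold qtest
      rw [norm_sub_rev]; ring
    have := hsup.2 (qtest (-c) (-d) z.1 z.2.2) (qtest_contDiff _ _ _ _) z'
      (Eventually.of_forall fun a => by
        have := hmax z a
        simp only [hneg]; linarith)
    rw [qtest_pdT, qtest_pdX, qtest_pdY] at this
    have e1 : 2 * -d * (z'.2.2 - z.2.2) = 2 * d * (z.2.2 - z'.2.2) := by ring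
    have e2 : (2 * -c) • (z'.1 - z.1) = (2 * c) • (z.1 - z'.1) := by
      rw [← neg_sub z.1 z'.1, smul_neg, ← neg_smul]; congr 1; ring
    rwa [e1, e2] at this

set_option maxHeartbeats 1000000 in
/-- The key estimate: the `y`-oscillation is arbitrarily small. -/
lemma osc_small {n : ℕ} {G : Ham n} {C₁ C₂ C₃ C₄ C₅ : ℝ}
    (h1 : HypH1 G) (h2 : HypH2 G C₁ C₂) (h3 : HypH3 G 0 C₃ C₄ C₅)
    {α : ℝ} (hα : 0 < α) {w : Dom n → ℝ} (hper : STPeriodic w) (hsol : ViscSol G α 0 w)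
    {M : ℝ} (hM0 : 0 ≤ M) (hM : ∀ z, |w z| ≤ M) {η : ℝ} (hη : 0 < η)
    (x : Euc n) (y y' t : ℝ) :
    α * (w (x, y, t) - w (x, y', t)) ≤
      (2 * C₄ * (1 + C₂ + α * M) + 4 * C₄ + 1) * η := by
  have hw := hsol.1
  obtain ⟨hC1, hC2, hco⟩ := h2
  have hC4 : 0 ≤ C₄ := h3.2.1
  set R : ℝ := n + 2 * M + 2 with hR
  have hn0 : (0 : ℝ) ≤ n := Nat.cast_nonneg n
  have hR0 : 0 ≤ R := by positivity
  -- uniform continuity of w on the ball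
  obtain ⟨σ₀, hσ₀, hwu⟩ := Metric.uniformContinuousOn_iff.1
    ((isCompact_closedBall (0 : Dom n) R).uniformContinuousOn_of_continuous hw.continuousOn) η hη
  -- choice of σ
  obtain ⟨σ, hσ, hσ1, hσ2, hσ3⟩ : ∃ σ > 0, σ < σ₀ ∧ σ ≤ η ∧ C₄ * σ ≤ 1 / 2 := by
    refine ⟨min (σ₀ / 2) (min η (1 / (2 * C₄ + 1) / 2)), ?_, ?_, ?_, ?_⟩
    · have : 0 < 1 / (2 * C₄ + 1) / 2 := by positivity
      exact lt_min (by linarith) (lt_min hη this)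
    · exact (min_le_left _ _).trans_lt (by linarith)
    · exact (min_le_right _ _).trans (min_le_left _ _)
    · calc C₄ * min (σ₀ / 2) (min η (1 / (2 * C₄ + 1) / 2))
          ≤ C₄ * (1 / (2 * C₄ + 1) / 2) :=
            mul_le_mul_of_nonneg_left ((min_le_right _ _).trans (min_le_right _ _)) hC4
        _ ≤ 1 / 2 := by
          have : C₄ * (1 / (2 * C₄ + 1) / 2) = (C₄ / (2 * C₄ + 1)) / 2 := by ring
          rw [this]
          have : C₄ / (2 * C₄ + 1) ≤ 1 := by
            rw [div_le_one (by positivity)]; linarith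
          linarith
  -- choice of d
  obtain ⟨d, hd1, hd2⟩ : ∃ d : ℝ, 1 ≤ d ∧ 2 * M ≤ d * σ ^ 2 := by
    refine ⟨max 1 (2 * M / σ ^ 2), le_max_left _ _, ?_⟩
    calc 2 * M = 2 * M / σ ^ 2 * σ ^ 2 := by field_simp
      _ ≤ _ := by gcongr; exact le_max_right _ _
  -- bound for the gradient
  set P : ℝ := (C₂ + α * M + 2 * d * σ) / C₁ with hP
  -- uniform continuity of G
  have hGc : Continuous (fun q : Euc n × ℝ × ℝ × Euc n => G q.1 q.2.1 q.2.2.1 q.2.2.2 0) :=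
    h1.1.comp (f := fun q : Euc n × ℝ × ℝ × Euc n => ((q.1, q.2.1, q.2.2.1, q.2.2.2, 0) : Xi n))
      (by fun_prop)
  obtain ⟨ρ, hρ, hGu⟩ := Metric.uniformContinuousOn_iff.1
    ((isCompact_closedBall (0 : Euc n × ℝ × ℝ × Euc n) (max R P)).uniformContinuousOn_of_continuous
      hGc.continuousOn) η hη
  obtain ⟨c, hc1, hc2⟩ : ∃ c : ℝ, 1 ≤ c ∧ 2 * M < c * ρ ^ 2 := by
    refine ⟨max 1 ((2 * M + 1) / ρ ^ 2), le_max_left _ _, ?_⟩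
    calc 2 * M < 2 * M + 1 := by linarith
      _ = (2 * M + 1) / ρ ^ 2 * ρ ^ 2 := by field_simp
      _ ≤ _ := by gcongr; exact le_max_right _ _
  obtain ⟨⟨x₁, y₁, t₁⟩, hz, ⟨x₂, y₂, t₂⟩, hz', hmax⟩ := max_exists hw hper hM0 hM hc1 hd1
  obtain ⟨hs, hS⟩ := doubling hsol hmax
  simp only at hs hS
  set p := (2 * c) • (x₁ - x₂) with hp
  have b1 := abs_le.1 (hM (x₁, y₁, t₁))
  have b2 := abs_le.1 (hM (x₂, y₂, t₂))
  have hcd0 := hmax 0 0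
  have hm := hmax (x, y, t) (x, y', t)
  have ht := hmax (x₁, y₁, t₁) (x₂, y₂, t₁)
  simp only [qtest, sub_self, norm_zero, Prod.fst_zero, Prod.snd_zero, ne_eq,
    OfNat.ofNat_ne_zero, not_false_eq_true, zero_pow, mul_zero, add_zero, sub_zero] at hcd0 hm ht
  have cn : 0 ≤ c * ‖x₁ - x₂‖ ^ 2 := by positivity
  have dn : 0 ≤ d * (t₁ - t₂) ^ 2 := by positivity
  -- |t₁ - t₂| ≤ σ
  have hts : |t₁ - t₂| ≤ σ := by
    apply abs_le_of_sq_le_sq _ hσ.le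
    have : d * (t₁ - t₂) ^ 2 ≤ d * σ ^ 2 := by linarith
    exact le_of_mul_le_mul_left this (by linarith)
  have hxs : ‖x₁ - x₂‖ < ρ := by
    apply lt_of_pow_lt_pow_left₀ 2 hρ.le
    have : c * ‖x₁ - x₂‖ ^ 2 < c * ρ ^ 2 := by linarith
    exact lt_of_mul_lt_mul_left this (by linarith)
  -- ball memberships
  have hzb := mem_closedBall_zero_iff.1 hz
  have hzb' := mem_closedBall_zero_iff.1 hz'
  simp only [Prod.norm_mk, Real.norm_eq_abs, sup_le_iff] at hzb hzb'
  -- time oscillation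
  have hosc : d * (t₁ - t₂) ^ 2 ≤ η := by
    have := hwu (x₂, y₂, t₁) (dom_mem_ball hzb'.1 hzb'.2.1 hzb.2.2) (x₂, y₂, t₂) hz' (by
      simp only [Prod.dist_eq, dist_self, Real.dist_eq]
      have : |t₁ - t₂| < σ₀ := by linarith
      simp [this])
    rw [Real.dist_eq] at this
    have := (abs_lt.1 this).2
    linarith
  -- gradient bounds
  have hG1 : G x₁ y₁ t₁ p 0 ≤ α * M + 2 * d * |t₁ - t₂| := by
    have e1 : -(α * w (x₁, y₁, t₁)) ≤ α * M := by
      rw [← mul_neg]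
      exact mul_le_mul_of_nonneg_left (by linarith) hα.le
    have e2 : -(2 * d * (t₁ - t₂)) ≤ 2 * d * |t₁ - t₂| := by
      rw [← mul_neg]
      exact mul_le_mul_of_nonneg_left (neg_le_abs _) (by linarith)
    linarith
  have hGl := hco x₁ y₁ t₁ p
  have hpP : ‖p‖ ≤ P := by
    rw [hP, le_div_iff₀ hC1]
    have : 2 * d * |t₁ - t₂| ≤ 2 * d * σ := by gcongr
    linarith
  have hGabs : |G x₁ y₁ t₁ p 0| ≤ C₂ + α * M + 2 * d * |t₁ - t₂| := by
    have u1 : 0 ≤ C₁ * ‖p‖ := by positivity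
    have u2 : 0 ≤ α * M := by positivity
    have u3 : 0 ≤ 2 * d * |t₁ - t₂| := by positivity
    rw [abs_le]; constructor <;> linarith
  have hT := G_time h1 h3 x₁ y₁ t₁ t₂ p (by
    rw [abs_sub_comm]
    exact (mul_le_mul_of_nonneg_left hts hC4).trans hσ3)
  rw [abs_sub_comm t₂ t₁] at hT
  have hX := hGu (x₂, y₁, t₂, p) (by
      rw [mem_closedBall_zero_iff]
      simp only [Prod.norm_mk, Real.norm_eq_abs, sup_le_iff]
      exact ⟨le_max_of_le_left hzb'.1, le_max_of_le_left hzb.2.1, le_max_of_le_left hzb'.2.2,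
        le_max_of_le_right hpP⟩) (x₁, y₁, t₂, p) (by
      rw [mem_closedBall_zero_iff]
      simp only [Prod.norm_mk, Real.norm_eq_abs, sup_le_iff]
      exact ⟨le_max_of_le_left hzb.1, le_max_of_le_left hzb.2.1, le_max_of_le_left hzb'.2.2,
        le_max_of_le_right hpP⟩) (by
      simp only [Prod.dist_eq, dist_self]
      rw [dist_comm, dist_eq_norm]
      simp [hxs, hρ])
  rw [Real.dist_eq] at hX
  simp only at hX
  rw [G_indep_y h1 h3 x₂ y₂ y₁ t₂ p] at hS
  have f1 := (abs_lt.1 hX).2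
  have f2 := (abs_le.1 hT).2
  have f3 : 2 * C₄ * |t₁ - t₂| * (1 + |G x₁ y₁ t₁ p 0|) ≤
      2 * C₄ * (1 + C₂ + α * M) * η + 4 * C₄ * η := by
    calc 2 * C₄ * |t₁ - t₂| * (1 + |G x₁ y₁ t₁ p 0|)
        ≤ 2 * C₄ * |t₁ - t₂| * (1 + (C₂ + α * M + 2 * d * |t₁ - t₂|)) := by gcongr
      _ = 2 * C₄ * (1 + C₂ + α * M) * |t₁ - t₂| + 4 * C₄ * (d * |t₁ - t₂| ^ 2) := by ring
      _ ≤ 2 * C₄ * (1 + C₂ + α * M) * η + 4 * C₄ * η := by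
        rw [sq_abs]
        have : |t₁ - t₂| ≤ η := hts.trans hσ2
        gcongr
  have f4 : w (x, y, t) - w (x, y', t) ≤ w (x₁, y₁, t₁) - w (x₂, y₂, t₂) := by linarith
  have f5 := mul_le_mul_of_nonneg_left f4 hα.le
  refine f5.trans ?_
  rw [mul_sub, add_mul, add_mul, one_mul]
  linarith

lemma osc_le {n : ℕ} {G : Ham n} {C₁ C₂ C₃ C₄ C₅ : ℝ}
    (h1 : HypH1 G) (h2 : HypH2 G C₁ C₂) (h3 : HypH3 G 0 C₃ C₄ C₅)
    {α : ℝ} (hα : 0 < α) {w : Dom n → ℝ} (hper : STPeriodic w) (hsol : ViscSol G α 0 w)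
    (x : Euc n) (y y' t : ℝ) : w (x, y, t) ≤ w (x, y', t) := by
  obtain ⟨M, hM0, hM⟩ := periodic_bdd hsol.1 hper
  have hC2 : 0 < C₂ := h2.2.1
  have hC4 : 0 ≤ C₄ := h3.2.1
  set A := 2 * C₄ * (1 + C₂ + α * M) + 4 * C₄ + 1 with hA
  have hA0 : 0 < A := by positivity
  by_contra! hlt
  have hm : 0 < α * (w (x, y, t) - w (x, y', t)) := mul_pos hα (by linarith)
  have := osc_small h1 h2 h3 hα hper hsol hM0 hM
    (η := α * (w (x, y, t) - w (x, y', t)) / (2 * A)) (by positivity) x y y' t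
  rw [← hA] at this
  have e : A * (α * (w (x, y, t) - w (x, y', t)) / (2 * A)) =
      α * (w (x, y, t) - w (x, y', t)) / 2 := by field_simp
  linarith

/-- Under (H1)–(H3) with l = 0, every continuous space-time periodic
viscosity solution of `w_t + G + α w = 0` (α > 0) is independent of y. -/
theorem statement10 {n : ℕ} (hn : 0 < n) (G : Ham n) (C₁ C₂ C₃ C₄ C₅ : ℝ)
    (h1 : HypH1 G) (h2 : HypH2 G C₁ C₂) (h3 : HypH3 G 0 C₃ C₄ C₅)
    (α : ℝ) (hα : 0 < α) (w : Dom n → ℝ) (hper : STPeriodic w) (hsol : ViscSol G α 0 w) :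
    ∀ (x : Euc n) (y y' t : ℝ), w (x, y, t) = w (x, y', t) := by
  intro x y y' t
  exact le_antisymm (osc_le h1 h2 h3 hα hper hsol x y y' t) (osc_le h1 h2 h3 hα hper hsol x y' y t)
end
end
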